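/- arXiv:math/9712286 — 4 statements merged into one kernel-verified Lean document; each statement's English description precedes it below -/
import Mathlib

section
/- There exists a superatomic Boolean algebra B such that the number of automorphisms of B is strictly smaller than the number of endomorphisms of B, i.e. |Aut(B)| < |End(B)|. -/
open Cardinal

/-- A Boolean algebra is superatomic if every homomorphic image of it is atomic. -/
def Superatomic (B : Type) [BooleanAlgebra B] : Prop :=
  ∀ (C : Type) (_ : BooleanAlgebra C) (h : BoundedLatticeHom B C),
    Function.Surjective h → IsAtomic C

open Set Topology

/-- An infinite set all but finitely many of whose points lie in any given neighbourhood of `x`. -/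
def ConvergesTo (A : Set ℝ) (x : ℝ) : Prop :=
  A.Infinite ∧ ∀ U ∈ 𝓝 x, (A \ U).Finite

theorem ConvergesTo.inter_finite {A B : Set ℝ} {x y : ℝ} (hA : ConvergesTo A x)
    (hB : ConvergesTo B y) (hxy : x ≠ y) : (A ∩ B).Finite := by
  obtain ⟨U, V, hU, hV, hUV⟩ := t2_separation_nhds hxy
  refine ((hA.2 U hU).union (hB.2 V hV)).subset ?_
  rintro z ⟨hzA, hzB⟩
  by_cases hz : z ∈ U
  · exact Or.inr ⟨hzB, fun hzV => Set.disjoint_left.1 hUV hz hzV⟩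
  · exact Or.inl ⟨hzA, hz⟩

theorem ConvergesTo.unique {A : Set ℝ} {x y : ℝ} (hx : ConvergesTo A x)
    (hy : ConvergesTo A y) : x = y := by
  by_contra h
  exact hx.1 (by simpa using hx.inter_finite hy h)

theorem ConvergesTo.of_diff_finite {A B : Set ℝ} {x : ℝ} (hA : ConvergesTo A x)
    (hB : B.Infinite) (hBA : (B \ A).Finite) : ConvergesTo B x := by
  refine ⟨hB, fun U hU => (hBA.union (hA.2 U hU)).subset ?_⟩
  rintro z ⟨hz, hzU⟩
  by_cases h : z ∈ A
  · exact Or.inr ⟨h, hzU⟩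
  · exact Or.inl ⟨hz, h⟩

theorem exists_convergesTo_of_mem_closure {D : Set ℝ} {x : ℝ} (hx : x ∈ closure D)
    (hxD : x ∉ D) : ∃ A ⊆ D, ConvergesTo A x := by
  obtain ⟨u, huD, hu⟩ := mem_closure_iff_seq_limit.1 hx
  refine ⟨range u, range_subset_iff.2 huD, fun hfin => ?_, fun U hU => ?_⟩
  · obtain ⟨n, rfl⟩ := hfin.isClosed.mem_of_tendsto hu
      (Filter.Eventually.of_forall fun n => mem_range_self n)
    exact hxD (huD n)
  · obtain ⟨N, hN⟩ := Filter.eventually_atTop.1 (hu.eventually_mem hU)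
    refine ((finite_lt_nat N).image u).subset ?_
    rintro _ ⟨⟨n, rfl⟩, hn⟩
    exact ⟨n, not_le.1 fun h => hn (hN n h), rfl⟩

theorem exists_mem_notMem_of_mk_lt {κ : Type} {C : Set ℝ} (hC : 𝔠 ≤ #C) (hκ : #κ < 𝔠)
    (E : κ → Set ℝ) (hE : ∀ k, (E k).Countable) {D : Set ℝ} (hD : D.Countable) :
    ∃ x ∈ C, x ∉ D ∧ ∀ k, x ∉ E k := by
  by_contra! h
  have hsub : C ⊆ D ∪ ⋃ k, E k := by
    intro x hx
    by_cases hxD : x ∈ D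
    · exact Or.inl hxD
    · exact Or.inr (mem_iUnion.2 (h x hx hxD))
  have h1 : #(⋃ k, E k) < 𝔠 := by
    refine (mk_iUnion_le _).trans_lt (mul_lt_of_lt aleph0_le_continuum hκ ?_)
    refine (ciSup_le' fun k => ?_).trans_lt aleph0_lt_continuum
    exact (hE k).le_aleph0
  have h2 : #(D ∪ ⋃ k, E k : Set ℝ) < 𝔠 :=
    (mk_union_le _ _).trans_lt
      (add_lt_of_lt aleph0_le_continuum (hD.le_aleph0.trans_lt aleph0_lt_continuum) h1)
  exact absurd (hC.trans (mk_le_mk_of_subset hsub)) (not_le.2 h2)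

theorem continuum_le_mk_closure {E D : Set ℝ} (hE : ¬ E.Countable) (hED : E ⊆ closure D) :
    𝔠 ≤ #(closure D) := by
  obtain ⟨φ, hφ, -, hinj⟩ := (isClosed_closure (s := D)).exists_nat_bool_injection_of_not_countable
    fun h => hE (h.mono hED)
  have := mk_le_of_injective (f := fun x => (⟨φ x, hφ (mem_range_self x)⟩ : closure D))
    fun x y hxy => hinj (congrArg Subtype.val hxy)
  simpa using this

/-- A set of points of the support of `f`, still uncountable, which `f` moves off itself. -/
theorem exists_not_countable_disjoint_image {f : Equiv.Perm ℝ}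
    (hf : ¬ {x | f x ≠ x}.Countable) : ∃ E : Set ℝ, ¬ E.Countable ∧ Disjoint E (f '' E) := by
  by_contra! h
  refine hf (((countable_iUnion fun q : ℚ => not_not.1 fun hc =>
    h {x | f x < q ∧ (q : ℝ) < x} hc ?_).union (countable_iUnion fun q : ℚ => not_not.1 fun hc =>
    h {x | x < q ∧ (q : ℝ) < f x} hc ?_)).mono fun x hx => ?_)
  · rw [Set.disjoint_left]
    rintro _ hx ⟨y, hy, rfl⟩
    exact lt_asymm hx.2 hy.1
  · rw [Set.disjoint_left]
    rintro _ hx ⟨y, hy, rfl⟩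
    exact lt_asymm hx.1 hy.2
  · rcases lt_or_gt_of_ne hx with h | h
    · obtain ⟨q, hq⟩ := exists_rat_btwn h
      exact Or.inl (mem_iUnion.2 ⟨q, hq⟩)
    · obtain ⟨q, hq⟩ := exists_rat_btwn h
      exact Or.inr (mem_iUnion.2 ⟨q, hq⟩)

/-- Transfinite construction of convergent sequences `A i` inside prescribed countable sets, along
prescribed partial maps `d i n ↦ g i n`, whose limits avoid the images and preimages of the
sequences constructed before. -/
theorem exists_convergesTo_family (d g : ℝ → ℕ → ℝ) (hd : ∀ i, 𝔠 ≤ #(closure (range (d i)))) :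
    ∃ (r : ℝ → ℝ → Prop) (_ : IsWellOrder ℝ r) (x : ℝ → ℝ) (A : ℝ → Set ℝ),
      (∀ i, A i ⊆ range (d i) ∧ ConvergesTo (A i) (x i)) ∧
      ∀ i j, r j i → x i ≠ x j ∧ ¬ ConvergesTo (g j '' (d j ⁻¹' A j)) (x i) ∧
        ¬ ConvergesTo (d i '' (g i ⁻¹' A j)) (x i) := by
  obtain ⟨r, hr, hord⟩ := exists_ord_eq ℝ
  have step : ∀ i (prev : ∀ j, r j i → ℝ × Set ℝ), ∃ y : ℝ × Set ℝ,
      (y.2 ⊆ range (d i) ∧ ConvergesTo y.2 y.1) ∧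
      ∀ j (h : r j i), y.1 ≠ (prev j h).1 ∧
        ¬ ConvergesTo (g j '' (d j ⁻¹' (prev j h).2)) y.1 ∧
        ¬ ConvergesTo (d i '' (g i ⁻¹' (prev j h).2)) y.1 := by
    intro i prev
    have hcard : #{j // r j i} < 𝔠 := by
      have := card_typein_lt i hord
      rwa [mk_real] at this
    obtain ⟨x, hxC, hxD, hxE⟩ := exists_mem_notMem_of_mk_lt (hd i) hcard
      (fun j => {(prev j.1 j.2).1} ∪
        ({x | ConvergesTo (g j '' (d j ⁻¹' (prev j.1 j.2).2)) x} ∪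
          {x | ConvergesTo (d i '' (g i ⁻¹' (prev j.1 j.2).2)) x}))
      (fun j => (countable_singleton _).union
        ((Set.Subsingleton.countable fun _ h _ h' => ConvergesTo.unique h h').union
          (Set.Subsingleton.countable fun _ h _ h' => ConvergesTo.unique h h')))
      (countable_range (d i))
    obtain ⟨A, hA, hAx⟩ := exists_convergesTo_of_mem_closure hxC hxD
    refine ⟨(x, A), ⟨hA, hAx⟩, fun j h => ?_⟩
    have := hxE ⟨j, h⟩
    simp only [mem_union, mem_singleton_iff, mem_ofPred_eq, not_or] at this
    exact this
  choose F hF using step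
  have wf : WellFounded r := hr.wf
  have key : ∀ i, wf.fix F i = F i fun j _ => wf.fix F j := fun i => wf.fix_eq F i
  refine ⟨r, hr, fun i => (wf.fix F i).1, fun i => (wf.fix F i).2, fun i => ?_, fun i j h => ?_⟩
  · have := (hF i fun j _ => wf.fix F j).1
    rwa [← key] at this
  · have := (hF i fun j _ => wf.fix F j).2 j h
    rwa [← key] at this

/-- An almost disjoint family of countable sets of reals, only preserved by permutations of
countable support. -/
theorem exists_rigid_almostDisjoint_family : ∃ A : ℝ → Set ℝ, (∀ i, (A i).Infinite) ∧
    (∀ i, (A i).Countable) ∧ (∀ i j, i ≠ j → (A i ∩ A j).Finite) ∧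
    ∀ f : Equiv.Perm ℝ, (∀ i, ∃ j, (f '' A i \ A j).Finite ∧ (A j \ f '' A i).Finite) →
      {x | f x ≠ x}.Countable := by
  have hcard : #{p : (ℕ → ℝ) × (ℕ → ℝ) // 𝔠 ≤ #(closure (range p.1))} ≤ #ℝ := by
    refine (mk_subtype_le _).trans ?_
    simp [mk_real]
  have hne : Nonempty {p : (ℕ → ℝ) × (ℕ → ℝ) // 𝔠 ≤ #(closure (range p.1))} :=
    ⟨⟨(TopologicalSpace.denseSeq ℝ, 0), continuum_le_mk_closure
      (E := univ) not_countable_univ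
      (by rw [(TopologicalSpace.denseRange_denseSeq ℝ).closure_range])⟩⟩
  obtain ⟨φ⟩ := (Cardinal.le_def _ _).1 hcard
  have he := Function.invFun_surjective φ.injective
  set e := Function.invFun φ
  obtain ⟨r, hr, x, A, hA, hx⟩ := exists_convergesTo_family (fun i => (e i).1.1)
    (fun i => (e i).1.2) fun i => (e i).2
  have hxne : ∀ i j, i ≠ j → x i ≠ x j := by
    intro i j hij
    rcases trichotomous_of r i j with h | h | h
    · exact (hx _ _ h).1.symm
    · exact absurd h hij
    · exact (hx _ _ h).1
  refine ⟨A, fun i => (hA i).2.1, fun i => (countable_range _).mono (hA i).1,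
    fun i j hij => (hA i).2.inter_finite (hA j).2 (hxne i j hij), fun f hf => ?_⟩
  by_contra hcount
  obtain ⟨E, hE, hdisj⟩ := exists_not_countable_disjoint_image hcount
  have : Nonempty E := (nonempty_iff_ne_empty.2 fun h => hE (by simp [h])).to_subtype
  set d : ℕ → ℝ := fun n => (TopologicalSpace.denseSeq E n : ℝ) with hd
  have hdE : range d ⊆ E := range_subset_iff.2 fun n => (TopologicalSpace.denseSeq E n).2
  have hcl : E ⊆ closure (range d) := by
    have := Subtype.dense_iff.1 (TopologicalSpace.denseRange_denseSeq E)
    rwa [← range_comp] at this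
  obtain ⟨i, hi⟩ := he ⟨(d, f ∘ d), continuum_le_mk_closure hE hcl⟩
  have hAi : A i ⊆ range d := by simpa [hi] using (hA i).1
  have hinf : (f '' A i).Infinite := (hA i).2.1.image f.injective.injOn
  obtain ⟨j, hj₁, hj₂⟩ := hf i
  rcases trichotomous_of r j i with h | rfl | h
  · have hn := (hx i j h).2.2
    simp only [hi] at hn
    have hP : d '' (f ∘ d ⁻¹' A j) = range d ∩ f ⁻¹' A j := by
      rw [preimage_comp, image_preimage_eq_range_inter]
    rw [hP] at hn
    refine hn ((hA i).2.of_diff_finite (fun hfin => ?_) ?_)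
    · refine hinf ((hj₁.union (hfin.image f)).subset ?_)
      rintro _ ⟨y, hy, rfl⟩
      by_cases hyj : f y ∈ A j
      · exact Or.inr ⟨y, ⟨hAi hy, hyj⟩, rfl⟩
      · exact Or.inl ⟨⟨y, hy, rfl⟩, hyj⟩
    · refine (hj₂.preimage f.injective.injOn).subset ?_
      rintro y ⟨⟨-, hy⟩, hyi⟩
      exact ⟨hy, fun h => hyi (f.injective.mem_set_image.1 h)⟩
  · refine hinf (hj₁.subset fun y hy => ⟨hy, fun hyj => ?_⟩)
    exact Set.disjoint_left.1 hdisj (hdE (hAi hyj)) (image_mono (hAi.trans hdE) hy)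
  · have hn := (hx j i h).2.1
    simp only [hi] at hn
    have hP : (f ∘ d) '' (d ⁻¹' A i) = f '' A i := by
      rw [image_comp, image_preimage_eq_of_subset hAi]
    rw [hP] at hn
    exact hn ((hA j).2.of_diff_finite hinf hj₁)

section AlmostDisjoint

variable {S : Type} {A : S → Set S}

/-- `b` splits `a` trivially modulo finite sets. -/
def Decides (b a : Set S) : Prop :=
  (b ∩ a).Finite ∨ (a \ b).Finite

/-- `b` is contained, modulo a finite set, in a finite union of members of `A`. -/
def AlmostCovered (A : S → Set S) (b : Set S) : Prop :=
  ∃ F : Set S, F.Finite ∧ (b \ ⋃ i ∈ F, A i).Finite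

theorem Decides.compl {b a : Set S} (h : Decides b a) : Decides bᶜ a := by
  rcases h with h | h
  · exact Or.inr (h.subset fun x hx => ⟨not_not.1 hx.2, hx.1⟩)
  · exact Or.inl (h.subset fun x hx => ⟨hx.2, hx.1⟩)

theorem Decides.union {b c a : Set S} (hb : Decides b a) (hc : Decides c a) :
    Decides (b ∪ c) a := by
  rcases hb with hb | hb
  · rcases hc with hc | hc
    · exact Or.inl ((hb.union hc).subset fun x hx => hx.1.imp (⟨·, hx.2⟩) (⟨·, hx.2⟩))
    · exact Or.inr (hc.subset fun x hx => ⟨hx.1, fun h => hx.2 (Or.inr h)⟩)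
  · exact Or.inr (hb.subset fun x hx => ⟨hx.1, fun h => hx.2 (Or.inl h)⟩)

theorem Decides.inter {b c a : Set S} (hb : Decides b a) (hc : Decides c a) :
    Decides (b ∩ c) a := by
  simpa using (hb.compl.union hc.compl).compl

theorem AlmostCovered.mono {b c : Set S} (hc : AlmostCovered A c) (h : b ⊆ c) :
    AlmostCovered A b := by
  obtain ⟨F, hF, hcF⟩ := hc
  exact ⟨F, hF, hcF.subset (sdiff_le_sdiff_right h)⟩

theorem AlmostCovered.union {b c : Set S} (hb : AlmostCovered A b) (hc : AlmostCovered A c) :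
    AlmostCovered A (b ∪ c) := by
  obtain ⟨F, hF, hbF⟩ := hb
  obtain ⟨G, hG, hcG⟩ := hc
  refine ⟨F ∪ G, hF.union hG, (hbF.union hcG).subset ?_⟩
  rw [biUnion_union]
  rintro x ⟨hx | hx, hn⟩
  · exact Or.inl ⟨hx, fun h => hn (Or.inl h)⟩
  · exact Or.inr ⟨hx, fun h => hn (Or.inr h)⟩

theorem AlmostCovered.of_finite {b : Set S} (hb : b.Finite) : AlmostCovered A b :=
  ⟨∅, finite_empty, hb.subset sdiff_subset⟩

theorem AlmostCovered.self (i : S) : AlmostCovered A (A i) :=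
  ⟨{i}, finite_singleton i, by simp⟩

theorem AlmostCovered.countable {b : Set S} (hA : ∀ i, (A i).Countable)
    (hb : AlmostCovered A b) : b.Countable := by
  obtain ⟨F, hF, hbF⟩ := hb
  refine (hbF.countable.union (hF.countable.biUnion fun i _ => hA i)).mono fun x hx => ?_
  by_cases h : x ∈ ⋃ i ∈ F, A i
  · exact Or.inr h
  · exact Or.inl ⟨hx, h⟩

/-- The algebra generated by the finite sets and the members of the almost disjoint family `A`. -/
def adAlgebra (A : S → Set S) : BooleanSubalgebra (Set S) where
  carrier := {b | (∀ i, Decides b (A i)) ∧ (AlmostCovered A b ∨ AlmostCovered A bᶜ)}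
  compl_mem' := fun {b} hb => ⟨fun i => (hb.1 i).compl, by rw [compl_compl]; exact hb.2.symm⟩
  bot_mem' := ⟨fun i => Or.inl (by simp), Or.inl (.of_finite finite_empty)⟩
  supClosed' := by
    rintro b ⟨hb, hb'⟩ c ⟨hc, hc'⟩
    refine ⟨fun i => (hb i).union (hc i), ?_⟩
    rcases hb' with hb' | hb'
    · rcases hc' with hc' | hc'
      · exact Or.inl (hb'.union hc')
      · exact Or.inr (hc'.mono (compl_subset_compl.2 subset_union_right))
    · exact Or.inr (hb'.mono (compl_subset_compl.2 subset_union_left))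
  infClosed' := by
    rintro b ⟨hb, hb'⟩ c ⟨hc, hc'⟩
    refine ⟨fun i => (hb i).inter (hc i), ?_⟩
    rcases hb' with hb' | hb'
    · exact Or.inl (hb'.mono inter_subset_left)
    · rcases hc' with hc' | hc'
      · exact Or.inl (hc'.mono inter_subset_right)
      · exact Or.inr (compl_inter b c ▸ hb'.union hc')

theorem mem_adAlgebra_of_finite {b : Set S} (hb : b.Finite) : b ∈ adAlgebra A :=
  ⟨fun _ => Or.inl (hb.subset inter_subset_left), Or.inl (.of_finite hb)⟩

theorem self_mem_adAlgebra (hAD : ∀ i j, i ≠ j → (A i ∩ A j).Finite) (i : S) :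
    A i ∈ adAlgebra A := by
  refine ⟨fun j => ?_, Or.inl (.self i)⟩
  by_cases h : i = j
  · subst h
    exact Or.inr (by simp)
  · exact Or.inl (hAD i j h)

/-- A nonzero image `h b` is an atom when, for every `c ≤ b`, one of `c` and `b \ c` is sent
to `⊥`. -/
theorem isAtom_map_of_forall {B C : Type} [BooleanAlgebra B] [BooleanAlgebra C]
    {h : BoundedLatticeHom B C} (hs : Function.Surjective h) {b : B} (hb : h b ≠ ⊥)
    (H : ∀ c ≤ b, h c = ⊥ ∨ h (b \ c) = ⊥) : IsAtom (h b) := by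
  refine ⟨hb, fun y hy => ?_⟩
  obtain ⟨c, rfl⟩ := hs y
  have hc : h (b ⊓ c) = h c := by rw [map_inf, inf_eq_right]; exact hy.le
  rcases H (b ⊓ c) inf_le_left with h0 | h0
  · rwa [hc] at h0
  · exfalso
    rw [map_sdiff', hc, sdiff_eq_bot_iff] at h0
    exact hy.not_ge h0

/-- A homomorphism killing all singletons contained in a finite set kills that set. -/
theorem map_eq_bot_of_finite {C : Type} [BooleanAlgebra C]
    (h : BoundedLatticeHom (adAlgebra A) C) {b : Set S} (hb : b.Finite)
    (H : ∀ s (_ : s ∈ b), h ⟨{s}, mem_adAlgebra_of_finite (finite_singleton s)⟩ = ⊥) :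
    h ⟨b, mem_adAlgebra_of_finite hb⟩ = ⊥ := by
  induction b, hb using Set.Finite.induction_on with
  | empty => exact map_bot h
  | @insert a s _ hs ih =>
    have : (⟨insert a s, mem_adAlgebra_of_finite (hs.insert a)⟩ : adAlgebra A) =
        ⟨{a}, mem_adAlgebra_of_finite (finite_singleton a)⟩ ⊔ ⟨s, mem_adAlgebra_of_finite hs⟩ :=
      Subtype.ext (insert_eq a s)
    rw [this, map_sup, H a (mem_insert a s), ih fun t ht => H t (mem_insert_of_mem a ht), bot_sup_eq]

theorem superatomic_adAlgebra (hAD : ∀ i j, i ≠ j → (A i ∩ A j).Finite) :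
    Superatomic (adAlgebra A) := by
  intro C _ h hs
  refine ⟨fun y => ?_⟩
  obtain ⟨b, rfl⟩ := hs y
  refine or_iff_not_imp_left.2 fun hb => ?_
  by_cases h1 : ∃ s ∈ (b : Set S), h ⟨{s}, mem_adAlgebra_of_finite (finite_singleton s)⟩ ≠ ⊥
  · obtain ⟨s, hsb, hsne⟩ := h1
    refine ⟨_, isAtom_map_of_forall hs hsne fun c hc => ?_,
      OrderHomClass.mono h (singleton_subset_iff.2 hsb)⟩
    rcases subset_singleton_iff_eq.1 (show (c : Set S) ⊆ {s} from hc) with h0 | h0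
    · left
      rw [show c = ⊥ from Subtype.ext h0, map_bot]
    · right
      rw [show c = ⟨{s}, mem_adAlgebra_of_finite (finite_singleton s)⟩ from Subtype.ext h0,
        _root_.sdiff_self, map_bot]
  push Not at h1
  have hfin : ∀ c : adAlgebra A, c ≤ b → (c : Set S).Finite → h c = ⊥ := fun c hcb hc =>
    map_eq_bot_of_finite h hc fun s hs => h1 s (hcb hs)
  set a : S → adAlgebra A := fun i => ⟨A i, self_mem_adAlgebra hAD i⟩ with ha
  by_cases h2 : ∃ i, h (b ⊓ a i) ≠ ⊥
  · obtain ⟨i, hi⟩ := h2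
    refine ⟨_, isAtom_map_of_forall hs hi fun c hc => ?_, OrderHomClass.mono h inf_le_left⟩
    refine (c.2.1 i).imp (fun hf => hfin c (hc.trans inf_le_left) ?_)
      fun hf => hfin _ (sdiff_le.trans inf_le_left) ?_
    · exact hf.subset fun s hs => ⟨hs, (hc hs).2⟩
    · exact hf.subset fun s hs => ⟨hs.1.2, hs.2⟩
  push Not at h2
  have hcov : ∀ c : adAlgebra A, c ≤ b → AlmostCovered A c → h c = ⊥ := by
    rintro c hcb ⟨F, hF, hcF⟩
    induction F, hF using Set.Finite.induction_on generalizing c with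
    | empty => exact hfin c hcb (by simpa using hcF)
    | @insert i F _ _ ih =>
      rw [← sup_inf_sdiff c (a i), map_sup, ih (c \ a i) (sdiff_le.trans hcb) (hcF.subset ?_),
        eq_bot_mono (OrderHomClass.mono h (inf_le_inf_right _ hcb)) (h2 i), sup_bot_eq]
      rintro x ⟨⟨hx, hxi⟩, hxF⟩
      rw [biUnion_insert]
      exact ⟨hx, fun hn => hn.elim hxi hxF⟩
  refine ⟨_, isAtom_map_of_forall hs hb fun c hc => ?_, le_rfl⟩
  exact c.2.2.imp (hcov c hc) fun hf => hcov _ sdiff_le (hf.mono fun s hs => hs.2)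


theorem exists_map_singleton_eq (Φ : adAlgebra A ≃o adAlgebra A) (s : S) :
    ∃ t, Φ ⟨{s}, mem_adAlgebra_of_finite (finite_singleton s)⟩ =
      ⟨{t}, mem_adAlgebra_of_finite (finite_singleton t)⟩ := by
  have hne : Φ ⟨{s}, mem_adAlgebra_of_finite (finite_singleton s)⟩ ≠ ⊥ := by
    rw [Ne, map_eq_bot_iff]
    exact fun h => singleton_ne_empty s (congrArg Subtype.val h)
  obtain ⟨t, ht⟩ := nonempty_iff_ne_empty.2 fun h => hne (Subtype.ext h)
  refine ⟨t, ?_⟩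
  have hle : (⟨{t}, mem_adAlgebra_of_finite (finite_singleton t)⟩ : adAlgebra A) ≤
      Φ ⟨{s}, mem_adAlgebra_of_finite (finite_singleton s)⟩ := singleton_subset_iff.2 ht
  have hle' := (OrderIso.symm_apply_le Φ).2 hle
  rcases subset_singleton_iff_eq.1 (show ((Φ.symm _ : adAlgebra A) : Set S) ⊆ {s} from hle')
    with h0 | h0
  · exfalso
    have : Φ.symm ⟨{t}, mem_adAlgebra_of_finite (finite_singleton t)⟩ = ⊥ := Subtype.ext h0
    rw [map_eq_bot_iff] at this
    exact singleton_ne_empty t (congrArg Subtype.val this)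
  · exact (Φ.symm_apply_eq.1 (Subtype.ext h0)).symm

/-- Automorphisms are induced by permutations of the underlying set. -/
theorem exists_perm_of_orderIso (Φ : adAlgebra A ≃o adAlgebra A) :
    ∃ f : Equiv.Perm S, ∀ b, (Φ b : Set S) = f '' b := by
  choose f hf using exists_map_singleton_eq Φ
  choose g hg using exists_map_singleton_eq Φ.symm
  have hfg : ∀ s, f (g s) = s := fun s => by
    have := hf (g s)
    rw [← hg, OrderIso.apply_symm_apply] at this
    exact (singleton_injective (congrArg Subtype.val this)).symm
  have hgf : ∀ s, g (f s) = s := fun s => by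
    have := hg (f s)
    rw [← hf, OrderIso.symm_apply_apply] at this
    exact (singleton_injective (congrArg Subtype.val this)).symm
  refine ⟨⟨f, g, hgf, hfg⟩, fun b => ?_⟩
  ext t
  rw [Equiv.image_eq_preimage_symm]
  have h1 : (⟨{t}, mem_adAlgebra_of_finite (finite_singleton t)⟩ : adAlgebra A) ≤ Φ b ↔
      t ∈ (Φ b : Set S) := singleton_subset_iff
  have h2 : (⟨{g t}, mem_adAlgebra_of_finite (finite_singleton (g t))⟩ : adAlgebra A) ≤ b ↔
      g t ∈ (b : Set S) := singleton_subset_iff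
  rw [← h1, ← OrderIso.symm_apply_le, hg, h2]
  rfl

theorem exists_image_almost_eq [Uncountable S] (hinf : ∀ i, (A i).Infinite)
    (hcount : ∀ i, (A i).Countable) (hAD : ∀ i j, i ≠ j → (A i ∩ A j).Finite)
    (Φ : adAlgebra A ≃o adAlgebra A) (f : Equiv.Perm S) (hf : ∀ b, (Φ b : Set S) = f '' b)
    (i : S) : ∃ j, (f '' A i \ A j).Finite ∧ (A j \ f '' A i).Finite := by
  have hfi : (f '' A i).Infinite := (hinf i).image f.injective.injOn
  have hmem : f '' A i ∈ adAlgebra A := hf ⟨A i, self_mem_adAlgebra hAD i⟩ ▸ Subtype.property _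
  have hcov : AlmostCovered A (f '' A i) := by
    refine hmem.2.resolve_right fun h => not_countable_univ (α := S) ?_
    rw [← union_compl_self (f '' A i)]
    exact ((hcount i).image f).union (h.countable hcount)
  obtain ⟨F, hF, hfF⟩ := hcov
  obtain ⟨j, -, hj⟩ : ∃ j ∈ F, (f '' A i ∩ A j).Infinite := by
    by_contra! h
    refine hfi ((hfF.union (hF.biUnion fun j hj => h j hj)).subset fun x hx => ?_)
    by_cases hxF : x ∈ ⋃ j ∈ F, A j
    · obtain ⟨j, hj, hxj⟩ := mem_iUnion₂.1 hxF
      exact Or.inr (mem_iUnion₂.2 ⟨j, hj, hx, hxj⟩)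
    · exact Or.inl ⟨hx, hxF⟩
  refine ⟨j, ?_, (hmem.1 j).resolve_left hj⟩
  set b := Φ.symm ⟨A j, self_mem_adAlgebra hAD j⟩ with hb
  have hfb : A j = f '' b := by rw [← hf, hb, OrderIso.apply_symm_apply]
  rw [hfb, ← image_sdiff f.injective]
  refine ((b.2.1 i).resolve_left fun h => hj ?_).image f
  rw [hfb, ← image_inter f.injective, inter_comm]
  exact h.image f

theorem AlmostCovered.finite_setOf_subset (hinf : ∀ i, (A i).Infinite)
    (hAD : ∀ i j, i ≠ j → (A i ∩ A j).Finite) {b : Set S} (hb : AlmostCovered A b) :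
    {i | (A i \ b).Finite}.Finite := by
  obtain ⟨F, hF, hbF⟩ := hb
  refine hF.subset fun i hi => ?_
  by_contra hiF
  refine hinf i ((Finite.union hi (hbF.union (hF.biUnion fun j (hj : j ∈ F) =>
    hAD i j fun h => hiF (h ▸ hj)))).subset fun x hx => ?_)
  by_cases hxb : x ∈ b
  · by_cases hxF : x ∈ ⋃ j ∈ F, A j
    · obtain ⟨j, hj, hxj⟩ := mem_iUnion₂.1 hxF
      exact Or.inr (Or.inr (mem_iUnion₂.2 ⟨j, hj, hx, hxj⟩))
    · exact Or.inr (Or.inl ⟨hxb, hxF⟩)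
  · exact Or.inl ⟨hx, hxb⟩

/-- The value at `b` of the endomorphism attached to `Z`: it collapses `A s` to the point `s` for
each `s ∈ Z`, and sends every point outside `Z` to the ultrafilter of the sets whose complement is
almost covered. -/
def collapseSet (A : S → Set S) (Z b : Set S) : Set S :=
  {s | (s ∈ Z ∧ (A s \ b).Finite) ∨ (s ∉ Z ∧ AlmostCovered A bᶜ)}

theorem not_almostCovered_compl [Uncountable S] (hcount : ∀ i, (A i).Countable) {b : Set S}
    (hb : AlmostCovered A b) : ¬ AlmostCovered A bᶜ := fun h =>
  not_countable_univ (α := S) (union_compl_self b ▸ (hb.union h).countable hcount)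

theorem Decides.diff_union_finite_iff {a b c : Set S} (ha : a.Infinite) (hb : Decides b a)
    (hc : Decides c a) : (a \ (b ∪ c)).Finite ↔ (a \ b).Finite ∨ (a \ c).Finite := by
  refine ⟨fun h => ?_, ?_⟩
  · by_contra! hn
    refine ha ((h.union ((hb.resolve_right hn.1).union (hc.resolve_right hn.2))).subset
      fun x hx => ?_)
    by_cases hxb : x ∈ b
    · exact Or.inr (Or.inl ⟨hxb, hx⟩)
    · by_cases hxc : x ∈ c
      · exact Or.inr (Or.inr ⟨hxc, hx⟩)
      · exact Or.inl ⟨hx, fun h => h.elim hxb hxc⟩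
  · rintro (h | h)
    · exact h.subset (sdiff_le_sdiff_left subset_union_left)
    · exact h.subset (sdiff_le_sdiff_left subset_union_right)

theorem collapseSet_mem [Uncountable S] (hinf : ∀ i, (A i).Infinite)
    (hcount : ∀ i, (A i).Countable) (hAD : ∀ i j, i ≠ j → (A i ∩ A j).Finite) (Z : Set S)
    {b : Set S} (hb : b ∈ adAlgebra A) : collapseSet A Z b ∈ adAlgebra A := by
  rcases hb.2 with h | h
  · refine mem_adAlgebra_of_finite ((h.finite_setOf_subset hinf hAD).subset ?_)
    rintro s (hs | hs)
    · exact hs.2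
    · exact absurd hs.2 (not_almostCovered_compl hcount h)
  · rw [← compl_compl (collapseSet A Z b)]
    refine BooleanSubalgebra.compl_mem
      (mem_adAlgebra_of_finite ((h.finite_setOf_subset hinf hAD).subset fun s hs => ?_))
    by_cases hsZ : s ∈ Z
    · exact (hb.1 s).compl.resolve_left fun hfin =>
        hs (Or.inl ⟨hsZ, hfin.subset fun x hx => ⟨hx.2, hx.1⟩⟩)
    · exact absurd (Or.inr ⟨hsZ, h⟩) hs

/-- The endomorphism with values `collapseSet A Z b`. -/
def collapseHom [Uncountable S] (hinf : ∀ i, (A i).Infinite)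
    (hcount : ∀ i, (A i).Countable) (hAD : ∀ i j, i ≠ j → (A i ∩ A j).Finite) (Z : Set S) :
    BoundedLatticeHom (adAlgebra A) (adAlgebra A) where
  toFun b := ⟨collapseSet A Z b, collapseSet_mem hinf hcount hAD Z b.2⟩
  map_sup' b c := by
    refine Subtype.ext (Set.ext fun s => ?_)
    have h1 := (b.2.1 s).diff_union_finite_iff (hinf s) (c.2.1 s)
    have h2 : AlmostCovered A ((b : Set S) ∪ c)ᶜ ↔
        AlmostCovered A (b : Set S)ᶜ ∨ AlmostCovered A (c : Set S)ᶜ := by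
      refine ⟨fun h => ?_, fun h => h.elim
        (·.mono (compl_subset_compl.2 subset_union_left))
        (·.mono (compl_subset_compl.2 subset_union_right))⟩
      by_contra! hn
      exact not_almostCovered_compl hcount
        ((b.2.2.resolve_right hn.1).union (c.2.2.resolve_right hn.2)) h
    change (_ ∧ (A s \ ((b : Set S) ∪ c)).Finite) ∨ (_ ∧ AlmostCovered A ((b : Set S) ∪ c)ᶜ) ↔
      (_ ∨ _) ∨ (_ ∨ _)
    rw [h1, h2]
    tauto
  map_inf' b c := by
    refine Subtype.ext (Set.ext fun s => ?_)
    have h1 : (A s \ ((b : Set S) ∩ c)).Finite ↔ (A s \ b).Finite ∧ (A s \ c).Finite := by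
      rw [sdiff_inter, finite_union]
    have h2 : AlmostCovered A ((b : Set S) ∩ c)ᶜ ↔
        AlmostCovered A (b : Set S)ᶜ ∧ AlmostCovered A (c : Set S)ᶜ := by
      rw [compl_inter]
      exact ⟨fun h => ⟨h.mono subset_union_left, h.mono subset_union_right⟩, fun h => h.1.union h.2⟩
    change (_ ∧ (A s \ ((b : Set S) ∩ c)).Finite) ∨ (_ ∧ AlmostCovered A ((b : Set S) ∩ c)ᶜ) ↔
      (_ ∨ _) ∧ (_ ∨ _)
    rw [h1, h2]
    tauto
  map_top' := by
    refine Subtype.ext (Set.ext fun s => ⟨fun _ => trivial, fun _ => ?_⟩)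
    by_cases hs : s ∈ Z
    · exact Or.inl ⟨hs, by simp⟩
    · exact Or.inr ⟨hs, .of_finite (by simp)⟩
  map_bot' := by
    refine Subtype.ext (Set.ext fun s => ⟨?_, False.elim⟩)
    rintro (h | h)
    · exact hinf s (by simpa using h.2)
    · exact not_almostCovered_compl hcount (.of_finite finite_empty) h.2

theorem collapseHom_injective [Uncountable S] (hinf : ∀ i, (A i).Infinite)
    (hcount : ∀ i, (A i).Countable) (hAD : ∀ i j, i ≠ j → (A i ∩ A j).Finite) :
    Function.Injective (collapseHom hinf hcount hAD) := by
  have key : ∀ Z s, s ∈ (collapseHom hinf hcount hAD Z ⟨A s, self_mem_adAlgebra hAD s⟩ : Set S) ↔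
      s ∈ Z := by
    refine fun Z s => ⟨?_, fun hs => Or.inl ⟨hs, by simp⟩⟩
    rintro (h | h)
    · exact h.1
    · exact absurd h.2 (not_almostCovered_compl hcount (.self s))
  intro Z W h
  ext s
  rw [← key Z s, h, key W s]

end AlmostDisjoint

theorem mk_countable_support_perm_real_le :
    #{f : Equiv.Perm ℝ // {x | f x ≠ x}.Countable} ≤ 𝔠 := by
  have hcount : ∀ f : {f : Equiv.Perm ℝ // {x | f x ≠ x}.Countable},
      #((fun x => (x, f.1 x)) '' {x | f.1 x ≠ x} : Set (ℝ × ℝ)) ≤ ℵ₀ :=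
    fun f => (f.2.image _).le_aleph0
  have hinj : Function.Injective fun f : {f : Equiv.Perm ℝ // {x | f x ≠ x}.Countable} =>
      (⟨_, hcount f⟩ : {t : Set (ℝ × ℝ) // #t ≤ ℵ₀}) := by
    have key : ∀ f g : {f : Equiv.Perm ℝ // {x | f x ≠ x}.Countable},
        (fun x => (x, f.1 x)) '' {x | f.1 x ≠ x} = (fun x => (x, g.1 x)) '' {x | g.1 x ≠ x} →
        ∀ x, f.1 x ≠ x → g.1 x = f.1 x := by
      intro f g h x hx
      obtain ⟨y, -, hy⟩ := h.subset (mem_image_of_mem _ hx)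
      obtain ⟨rfl, hy⟩ := Prod.mk.inj hy
      exact hy
    intro f g h
    have h' := congrArg Subtype.val h
    refine Subtype.ext (Equiv.ext fun x => ?_)
    by_cases hf : f.1 x = x
    · by_cases hg : g.1 x = x
      · rw [hf, hg]
      · exact key g f h'.symm x hg
    · exact (key f g h' x hf).symm
  refine (mk_le_of_injective hinj).trans ((mk_bounded_set_le _ _).trans ?_)
  simp [mk_real, max_eq_left aleph0_le_continuum]

/-- There is a superatomic Boolean algebra with fewer automorphisms than endomorphisms. -/
theorem exists_superatomic_aut_lt_end :
    ∃ (B : Type) (_ : BooleanAlgebra B), Superatomic B ∧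
      #(B ≃o B) < #(BoundedLatticeHom B B) := by
  obtain ⟨A, hinf, hcount, hAD, hrigid⟩ := exists_rigid_almostDisjoint_family
  refine ⟨adAlgebra A, inferInstance, superatomic_adAlgebra hAD, ?_⟩
  choose f hf using exists_perm_of_orderIso (A := A)
  have haut : #(adAlgebra A ≃o adAlgebra A) ≤ 𝔠 := by
    refine (mk_le_of_injective (f := fun Φ => (⟨f Φ, hrigid _
      (exists_image_almost_eq hinf hcount hAD Φ (f Φ) (hf Φ))⟩ :
        {f : Equiv.Perm ℝ // {x | f x ≠ x}.Countable})) fun Φ Ψ h => ?_).trans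
      mk_countable_support_perm_real_le
    have h' : f Φ = f Ψ := congrArg Subtype.val h
    exact OrderIso.ext (funext fun b => Subtype.ext (by rw [hf, hf, h']))
  refine haut.trans_lt ((cantor 𝔠).trans_le ?_)
  have := mk_le_of_injective (collapseHom_injective hinf hcount hAD)
  rwa [mk_set, mk_real] at this
end

section
/- There exists a superatomic Boolean algebra B such that |Aut(B)| < |B|. -/
open Cardinal

/-- The disjoint union of representatives of the cardinals `ℶ_ n`. -/
abbrev BethSum : Type := Σ n : ℕ, (ℶ_ (n : Ordinal.{0})).out

/-- The disjoint union of the first `n + 1` representatives. -/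
def bethInitial (n : ℕ) : Set BethSum := {x | x.1 ≤ n}

lemma mk_bethInitial_le (n : ℕ) : #(bethInitial n) ≤ ℶ_ (n : Ordinal.{0}) := by
  have h : ∀ m : {m : ℕ // m ≤ n},
      Nonempty ((ℶ_ (m.1 : Ordinal.{0})).out ↪ (ℶ_ (n : Ordinal.{0})).out) := by
    intro m
    rw [← Cardinal.le_def]
    simp only [Cardinal.mk_out]
    exact Cardinal.beth_mono (by exact_mod_cast m.2)
  have e := fun m => (h m).some
  have : #(bethInitial n) ≤ #(ℕ × (ℶ_ (n : Ordinal.{0})).out) := by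
    refine ⟨⟨fun x => (x.1.1, e ⟨x.1.1, x.2⟩ x.1.2), ?_⟩⟩
    rintro ⟨⟨a, x⟩, hx⟩ ⟨⟨b, y⟩, hy⟩ hxy
    simp only [Prod.mk.injEq] at hxy
    obtain ⟨rfl, h2⟩ := hxy
    have := (e _).injective h2
    subst this
    rfl
  refine this.trans ?_
  rw [Cardinal.mk_prod]
  simp only [Cardinal.lift_id, Cardinal.mk_out, Cardinal.mk_nat]
  exact Cardinal.mul_le_of_le (Cardinal.aleph0_le_beth _) (Cardinal.aleph0_le_beth _) le_rfl

lemma aleph0_le_mk_bethInitial (n : ℕ) : ℵ₀ ≤ #(bethInitial n) := by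
  have : #((ℶ_ ((0 : ℕ) : Ordinal.{0})).out) ≤ #(bethInitial n) := by
    refine ⟨⟨fun x => ⟨⟨0, x⟩, Nat.zero_le _⟩, ?_⟩⟩
    intro x y hxy
    exact eq_of_heq (Sigma.mk.inj (congrArg Subtype.val hxy)).2
  rw [Cardinal.mk_out] at this
  exact (Cardinal.aleph0_le_beth _).trans this

/-- The levels of the tree of bounded approximations to subsets of `BethSum`. -/
abbrev BethApprox : Type := Σ n : ℕ, Set (bethInitial n)

lemma mk_bethApprox_le : #BethApprox ≤ #BethSum := by
  rw [Cardinal.mk_sigma]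
  have hR : ℵ₀ ≤ #BethSum := (aleph0_le_mk_bethInitial 0).trans (Cardinal.mk_set_le _)
  have h : ∀ n, #(Set (bethInitial n)) ≤ #BethSum := by
    intro n
    rw [Cardinal.mk_set]
    refine (Cardinal.power_le_power_left two_ne_zero (mk_bethInitial_le n)).trans ?_
    rw [← Cardinal.beth_succ]
    have : #((ℶ_ ((n + 1 : ℕ) : Ordinal.{0})).out) ≤ #BethSum :=
      ⟨Function.Embedding.sigmaMk (β := fun n : ℕ => (ℶ_ (n : Ordinal.{0})).out) (n + 1)⟩
    rw [Cardinal.mk_out] at this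
    simpa using this
  refine (Cardinal.sum_le_sum _ (fun _ => #BethSum) h).trans ?_
  simp only [Cardinal.sum_const, Cardinal.mk_nat, Cardinal.lift_id]
  exact Cardinal.mul_le_of_le hR hR le_rfl

lemma two_power_aleph0_le_mk_bethApprox : 2 ^ ℵ₀ ≤ #BethApprox := by
  have : #(Set (bethInitial 0)) ≤ #BethApprox :=
    ⟨Function.Embedding.sigmaMk (β := fun n : ℕ => Set (bethInitial n)) 0⟩
  rw [Cardinal.mk_set] at this
  exact (Cardinal.power_le_power_left two_ne_zero (aleph0_le_mk_bethInitial 0)).trans this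

/-- The branch of approximations to a subset of `BethSum`. -/
def bethBranch (S : Set BethSum) : Set BethApprox :=
  Set.range fun n => ⟨n, Subtype.val ⁻¹' S⟩

lemma bethBranch_infinite (S : Set BethSum) : (bethBranch S).Infinite := by
  refine Set.infinite_range_of_injective fun m n h => ?_
  exact congrArg Sigma.fst h

lemma bethBranch_countable (S : Set BethSum) : (bethBranch S).Countable :=
  Set.countable_range _

lemma bethBranch_inter_finite {S T : Set BethSum} (h : S ≠ T) :
    (bethBranch S ∩ bethBranch T).Finite := by
  obtain ⟨x, hx⟩ : ∃ x, ¬(x ∈ S ↔ x ∈ T) := by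
    by_contra! H
    exact h (Set.ext H)
  refine ((Set.finite_Iio x.1).image fun n => (⟨n, Subtype.val ⁻¹' S⟩ : BethApprox)).subset ?_
  rintro _ ⟨⟨n, rfl⟩, ⟨m, hm⟩⟩
  refine ⟨n, ?_, rfl⟩
  by_contra hn
  obtain rfl : m = n := congrArg Sigma.fst hm
  have h2 : (Subtype.val ⁻¹' T : Set (bethInitial m)) = Subtype.val ⁻¹' S := by
    simpa using hm
  have hxm : x ∈ bethInitial m := by simpa [bethInitial] using hn
  have := Set.ext_iff.1 h2 ⟨x, hxm⟩
  exact hx this.symm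

theorem exists_almostDisjoint_family :
    ∃ (Y I : Type) (D : I → Set Y), 2 ^ ℵ₀ ≤ #Y ∧ 2 ^ #Y ≤ #I ∧
      (∀ i, (D i).Infinite) ∧ (∀ i, (D i).Countable) ∧
      ∀ i j, i ≠ j → (D i ∩ D j).Finite :=
  ⟨BethApprox, Set BethSum, bethBranch, two_power_aleph0_le_mk_bethApprox, by
    rw [Cardinal.mk_set]
    exact Cardinal.power_le_power_left two_ne_zero mk_bethApprox_le,
    bethBranch_infinite, bethBranch_countable, fun _ _ => bethBranch_inter_finite⟩

/-- The initial segment below `β` of the branch determined by `b` in the tree of sets of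
elements of `K`. -/
def branchBelow {K : Type} [LinearOrder K] (p : WithTop K × Set K) :
    Set (Σ α : K, Set (Set.Iic α)) :=
  {x | (x.1 : WithTop K) < p.1 ∧ x.2 = Subtype.val ⁻¹' p.2}

lemma branchBelow_subset_or {K : Type} [LinearOrder K] (p q : WithTop K × Set K) :
    branchBelow p ⊆ branchBelow q ∨
      ∃ r : WithTop K × Set K, r.1 < p.1 ∧ branchBelow p ∩ branchBelow q ⊆ branchBelow r := by
  rcases lt_or_ge q.1 p.1 with h | h
  · exact Or.inr ⟨q, h, Set.inter_subset_right⟩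
  by_cases H : ∃ δ : K, (δ : WithTop K) < p.1 ∧ ∃ y ≤ δ, ¬(y ∈ p.2 ↔ y ∈ q.2)
  · obtain ⟨δ, hδ, y, hy, hne⟩ := H
    refine Or.inr ⟨(δ, p.2), hδ, ?_⟩
    rintro ⟨α, a⟩ ⟨⟨h1, h2⟩, h3, h4⟩
    refine ⟨?_, h2⟩
    by_contra hα
    have hα' : δ ≤ α := by simpa using hα
    have := Set.ext_iff.1 (h2.symm.trans h4) ⟨y, hy.trans hα'⟩
    exact hne this
  · push Not at H
    refine Or.inl ?_
    rintro ⟨α, a⟩ ⟨h1, h2⟩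
    refine ⟨h1.trans_le h, h2.trans ?_⟩
    ext ⟨y, hy⟩
    exact H α h1 y hy

lemma branchBelow_top_injective {K : Type} [LinearOrder K] :
    Function.Injective fun b : Set K => branchBelow (⊤, b) := by
  intro b c h
  ext y
  have : (⟨y, Subtype.val ⁻¹' b⟩ : Σ α : K, Set (Set.Iic α)) ∈ branchBelow (⊤, c) :=
    (Set.ext_iff.1 h ⟨y, Subtype.val ⁻¹' b⟩).1 ⟨WithTop.coe_lt_top y, rfl⟩
  exact Set.ext_iff.1 this.2 ⟨y, le_refl y⟩

theorem exists_tree_family (μ : Cardinal.{0}) (hμ : ℵ₀ ≤ μ) :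
    ∃ (X ι : Type) (r : ι → ι → Prop) (A : ι → Set X), WellFounded r ∧ #X ≤ μ ∧
      μ < #(Set.range A) ∧ ∀ i j, A i ⊆ A j ∨ ∃ k, r k i ∧ A i ∩ A j ⊆ A k := by
  obtain ⟨κ, hκ, hmin⟩ := WellFounded.has_min (r := ((· < ·) : Cardinal.{0} → Cardinal.{0} → Prop))
    wellFounded_lt {κ | μ < 2 ^ κ} ⟨μ, cantor μ⟩
  have hκμ : κ ≤ μ := le_of_not_gt fun h => hmin μ (cantor μ) h
  have hκ0 : ℵ₀ ≤ κ := by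
    by_contra! h
    exact (hμ.trans_lt hκ).not_ge (power_lt_aleph0 (natCast_lt_aleph0 (n := 2)) h).le
  have hsmall : ∀ α : κ.ord.ToType, #(Set.Iic α) < κ := by
    intro α
    have h1 : #(Set.Iio α) < κ := by
      have := mk_Iio_lt α (by simp)
      simpa using this
    rw [← Set.Iio_insert]
    refine (mk_insert_le).trans_lt ?_
    exact add_lt_of_lt hκ0 h1 (one_lt_aleph0.trans_le hκ0)
  refine ⟨Σ α : κ.ord.ToType, Set (Set.Iic α), WithTop κ.ord.ToType × Set κ.ord.ToType,
    fun p q => p.1 < q.1, branchBelow, InvImage.wf _ wellFounded_lt, ?_, ?_,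
    branchBelow_subset_or⟩
  · rw [mk_sigma]
    refine (sum_le_sum _ (fun _ => μ) fun α => ?_).trans ?_
    · rw [mk_set]
      exact le_of_not_gt fun h => hmin _ h (hsmall α)
    · simp only [sum_const, lift_id, mk_ord_toType]
      exact mul_le_of_le hμ hκμ le_rfl
  · refine lt_of_lt_of_le (b := #(Set κ.ord.ToType)) ?_ ?_
    · rw [mk_set, mk_ord_toType]
      exact hκ
    · exact ⟨⟨fun b => ⟨_, (⊤, b), rfl⟩, fun b c h => branchBelow_top_injective
        (congrArg Subtype.val h)⟩⟩

/-- `D` is homogeneous for the family `A` if every member of `A` splits `D` trivially,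
up to a finite set. -/
def Homogeneous {X ι : Type} (A : ι → Set X) (D : Set X) : Prop :=
  ∀ i, (D ∩ A i).Finite ∨ (D \ A i).Finite

lemma Homogeneous.mono {X ι : Type} {A : ι → Set X} {D E : Set X} (hD : Homogeneous A D)
    (h : E ⊆ D) : Homogeneous A E := fun i =>
  (hD i).imp (fun f => f.subset (Set.inter_subset_inter_left _ h))
    fun f => f.subset (Set.sdiff_subset_sdiff_left h)

lemma exists_infinite_homogeneous {X ι : Type} {r : ι → ι → Prop} (hr : WellFounded r)
    {A : ι → Set X} (hA : ∀ i j, A i ⊆ A j ∨ ∃ k, r k i ∧ A i ∩ A j ⊆ A k)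
    {D : Set X} (hD : D.Infinite) : ∃ E ⊆ D, E.Infinite ∧ Homogeneous A E := by
  by_cases H : ∃ i, (D ∩ A i).Infinite
  · obtain ⟨i, hi, hmin⟩ := hr.has_min {i | (D ∩ A i).Infinite} H
    refine ⟨D ∩ A i, Set.inter_subset_left, hi, fun j => ?_⟩
    rcases hA i j with h | ⟨k, hk, h⟩
    · right
      convert Set.finite_empty
      exact Set.sdiff_eq_empty.2 (Set.inter_subset_right.trans h)
    · left
      have : (D ∩ A k).Finite := Set.not_infinite.1 fun hinf => hmin k hinf hk
      refine this.subset ?_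
      rw [Set.inter_assoc]
      exact Set.inter_subset_inter_right _ h
  · push Not at H
    exact ⟨D, subset_rfl, hD, fun i => Or.inl (Set.not_infinite.1 (by simpa using H i))⟩

lemma mk_image_inter_infinite_lt {X Y I : Type} {D : I → Set Y} (hY : 2 ^ ℵ₀ ≤ #Y)
    (hD : ∀ i j, i ≠ j → (D i ∩ D j).Finite) {𝓕 : Set (Set X)} (h𝓕 : #𝓕 < 2 ^ #Y)
    (hc : ∀ F ∈ 𝓕, F.Countable) {u : Y → X} (hu : Function.Injective u) :
    #{i | ∃ F ∈ 𝓕, (u '' D i ∩ F).Infinite} < 2 ^ #Y := by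
  have h1 : ∀ F : 𝓕, #{i | (u '' D i ∩ F.1).Infinite} ≤ 2 ^ ℵ₀ := by
    intro F
    have : #{i | (u '' D i ∩ F.1).Infinite} ≤ #(Set F.1) := by
      refine ⟨⟨fun i => Subtype.val ⁻¹' (u '' D i.1), ?_⟩⟩
      rintro ⟨i, hi⟩ ⟨j, hj⟩ hij
      by_contra hne
      replace hne : i ≠ j := fun h => hne (Subtype.ext h)
      refine hi (((hD i j hne).image u).subset ?_)
      rw [Set.image_inter hu]
      rintro x ⟨hx, hxF⟩
      exact ⟨hx, (Set.ext_iff.1 hij ⟨x, hxF⟩).1 hx⟩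
    refine this.trans ?_
    rw [mk_set]
    exact power_le_power_left two_ne_zero (mk_le_aleph0_iff.2 (hc _ F.2).to_subtype)
  have h2 : {i | ∃ F ∈ 𝓕, (u '' D i ∩ F).Infinite} =
      ⋃ F : 𝓕, {i | (u '' D i ∩ F.1).Infinite} := by
    ext i
    simp
  have hY0 : ℵ₀ ≤ 2 ^ #Y := (cantor ℵ₀).le.trans (hY.trans (cantor _).le)
  rw [h2]
  refine (mk_iUnion_le_sum_mk).trans_lt ((sum_le_sum _ (fun _ => 2 ^ ℵ₀) h1).trans_lt ?_)
  simp only [sum_const, lift_id]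
  exact mul_lt_of_lt hY0 h𝓕 (hY.trans_lt (cantor _))

/-- A set `x` of sets spoils the partial map sending `u y` to `v y` if some member of `x` is
sent to a set which is split by another member of `x`. -/
def Spoils {X Y : Type} (u v : Y → X) (x : Set (Set X)) : Prop :=
  ∃ a ∈ x, ∃ a' ∈ x, a ⊆ Set.range u ∧ a'.Infinite ∧ a' ⊆ v '' (u ⁻¹' a) ∧
    (v '' (u ⁻¹' a) \ a').Infinite

lemma exists_infinite_subset_diff_infinite {X : Type} {E : Set X} (hE : E.Infinite) :
    ∃ F ⊆ E, F.Infinite ∧ (E \ F).Infinite := by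
  have e := hE.natEmbedding
  refine ⟨Set.range fun n => (e (2 * n)).1, ?_, ?_, ?_⟩
  · rintro _ ⟨n, rfl⟩
    exact (e _).2
  · refine Set.infinite_range_of_injective fun m n h => ?_
    have := e.injective (Subtype.ext h)
    omega
  · refine (Set.infinite_range_of_injective (f := fun n => (e (2 * n + 1)).1) ?_).mono ?_
    · intro m n h
      have := e.injective (Subtype.ext h)
      omega
    · rintro _ ⟨n, rfl⟩
      refine ⟨(e _).2, ?_⟩
      rintro ⟨m, h⟩
      have := e.injective (Subtype.ext h)
      omega

lemma exists_spoiling_pair {X Y I ι : Type} {r : ι → ι → Prop} (hr : WellFounded r)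
    {A : ι → Set X} (hA : ∀ i j, A i ⊆ A j ∨ ∃ k, r k i ∧ A i ∩ A j ⊆ A k)
    {D : I → Set Y} (hY : 2 ^ ℵ₀ ≤ #Y) (hI : 2 ^ #Y ≤ #I) (hinf : ∀ i, (D i).Infinite)
    (hcount : ∀ i, (D i).Countable) (hD : ∀ i j, i ≠ j → (D i ∩ D j).Finite)
    {𝓕 : Set (Set X)} (h𝓕 : #𝓕 < 2 ^ #Y) (hc : ∀ F ∈ 𝓕, F.Countable) {u v : Y → X}
    (hu : Function.Injective u) (hv : Function.Injective v)
    (huv : Disjoint (Set.range u) (Set.range v)) :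
    ∃ x : Set (Set X), x.Countable ∧ (∀ a ∈ x, a.Countable ∧ Homogeneous A a) ∧
      (x.Pairwise fun a b => (a ∩ b).Finite) ∧ (∀ a ∈ x, ∀ F ∈ 𝓕, (a ∩ F).Finite) ∧
      Spoils u v x := by
  have hY0 : ℵ₀ ≤ 2 ^ #Y := (cantor ℵ₀).le.trans (hY.trans (cantor _).le)
  obtain ⟨i, hi⟩ : ∃ i, i ∉ {i | ∃ F ∈ 𝓕, (u '' D i ∩ F).Infinite} ∪
      {i | ∃ F ∈ 𝓕, (v '' D i ∩ F).Infinite} := by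
    by_contra! H
    have h := ((mk_union_le _ _).trans_lt (add_lt_of_lt hY0
      (mk_image_inter_infinite_lt hY hD h𝓕 hc hu) (mk_image_inter_infinite_lt hY hD h𝓕 hc hv)))
    rw [Set.eq_univ_of_forall H, mk_univ] at h
    exact h.not_ge hI
  simp only [Set.mem_union, Set.mem_ofPred_eq, not_or, not_exists, not_and,
    Set.not_infinite] at hi
  obtain ⟨a, ha, hainf, hah⟩ := exists_infinite_homogeneous hr hA
    ((hinf i).image hu.injOn)
  have hpre : u ⁻¹' a ⊆ D i := fun y hy => by
    obtain ⟨z, hz, hzy⟩ := ha hy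
    exact hu hzy ▸ hz
  have hpreinf : (v '' (u ⁻¹' a)).Infinite :=
    (hainf.preimage (ha.trans (Set.image_subset_range _ _))).image hv.injOn
  obtain ⟨E, hE, hEinf, hEh⟩ := exists_infinite_homogeneous hr hA hpreinf
  obtain ⟨a', ha', ha'inf, ha'diff⟩ := exists_infinite_subset_diff_infinite hEinf
  have ha'v : a' ⊆ v '' D i := ha'.trans (hE.trans (Set.image_mono hpre))
  have hdisj : a ∩ a' = ∅ := by
    rw [← Set.disjoint_iff_inter_eq_empty]
    exact huv.mono (ha.trans (Set.image_subset_range _ _)) (ha'v.trans (Set.image_subset_range _ _))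
  refine ⟨{a, a'}, by simp, ?_, ?_, ?_, a, by simp, a', by simp,
    ha.trans (Set.image_subset_range _ _), ha'inf, ha'.trans hE,
    ha'diff.mono (Set.sdiff_subset_sdiff_left hE)⟩
  · rintro b (rfl | rfl)
    · exact ⟨((hcount i).image u).mono ha, hah⟩
    · exact ⟨((hcount i).image v).mono ha'v, hEh.mono ha'⟩
  · rw [Set.pairwise_pair]
    intro _
    rw [Set.inter_comm a' a, hdisj]
    simp
  · rintro b (rfl | rfl) F hF
    · exact (hi.1 F hF).subset (Set.inter_subset_inter_left _ ha)
    · exact (hi.2 F hF).subset (Set.inter_subset_inter_left _ ha'v)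

lemma exists_recursive_choice {J α : Type} [LinearOrder J] [WellFoundedLT J] [Nonempty α]
    (P : J → Set α → α → Prop) :
    ∃ f : J → α, ∀ j, (∃ x, P j (f '' Set.Iio j) x) → P j (f '' Set.Iio j) (f j) := by
  classical
  let F : ∀ j : J, (∀ k, k < j → α) → α := fun j ih =>
    Classical.epsilon (P j (Set.range fun k : Set.Iio j => ih k.1 k.2))
  obtain ⟨f, hf⟩ : ∃ f : J → α, ∀ j, f j = Classical.epsilon (P j (f '' Set.Iio j)) := by
    refine ⟨(wellFounded_lt (α := J)).fix F, fun j => ?_⟩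
    rw [WellFounded.fix_eq, Set.image_eq_range]
  refine ⟨f, fun j hj => ?_⟩
  have h := Classical.epsilon_spec hj
  rwa [← hf] at h

theorem exists_spoiling_family {X Y I ι : Type} {r : ι → ι → Prop} (hr : WellFounded r)
    {A : ι → Set X} (hA : ∀ i j, A i ⊆ A j ∨ ∃ k, r k i ∧ A i ∩ A j ⊆ A k)
    {D : I → Set Y} (hY : 2 ^ ℵ₀ ≤ #Y) (hI : 2 ^ #Y ≤ #I) (hinf : ∀ i, (D i).Infinite)
    (hcount : ∀ i, (D i).Countable) (hD : ∀ i j, i ≠ j → (D i ∩ D j).Finite)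
    (hX : #X ≤ 2 ^ #Y) :
    ∃ 𝒜 : Set (Set X), (∀ a ∈ 𝒜, Homogeneous A a) ∧ (𝒜.Pairwise fun a b => (a ∩ b).Finite) ∧
      ∀ u v : Y → X, Function.Injective u → Function.Injective v →
        Disjoint (Set.range u) (Set.range v) → Spoils u v 𝒜 := by
  have hY0 : ℵ₀ ≤ #Y := (cantor ℵ₀).le.trans hY
  have hY1 : ℵ₀ ≤ 2 ^ #Y := hY0.trans (cantor _).le
  let T : Type := {p : (Y → X) × (Y → X) // Function.Injective p.1 ∧ Function.Injective p.2 ∧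
    Disjoint (Set.range p.1) (Set.range p.2)}
  have hT : #T ≤ 2 ^ #Y := by
    have h1 : #(Y → X) ≤ 2 ^ #Y := by
      rw [← power_def]
      refine (power_le_power_right hX).trans ?_
      rw [← power_mul, mul_eq_self hY0]
    refine (mk_subtype_le _).trans ?_
    rw [mk_prod]
    simp only [lift_id]
    exact mul_le_of_le hY1 h1 h1
  obtain ⟨e⟩ : Nonempty ((#T).ord.ToType ≃ T) := Cardinal.eq.1 (mk_ord_toType _)
  obtain ⟨f, hf⟩ := exists_recursive_choice (J := (#T).ord.ToType) (α := Set (Set X))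
    fun j s x => x.Countable ∧ (∀ a ∈ x, a.Countable ∧ Homogeneous A a) ∧
      (x.Pairwise fun a b => (a ∩ b).Finite) ∧ (∀ a ∈ x, ∀ F ∈ ⋃₀ s, (a ∩ F).Finite) ∧
      Spoils (e j).1.1 (e j).1.2 x
  have hf' : ∀ j, (f j).Countable ∧ (∀ a ∈ f j, a.Countable ∧ Homogeneous A a) ∧
      ((f j).Pairwise fun a b => (a ∩ b).Finite) ∧
      (∀ a ∈ f j, ∀ F ∈ ⋃₀ (f '' Set.Iio j), (a ∩ F).Finite) ∧
      Spoils (e j).1.1 (e j).1.2 (f j) := by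
    intro j
    induction j using WellFoundedLT.induction with
    | ind j ih =>
      refine hf j (exists_spoiling_pair hr hA hY hI hinf hcount hD ?_ ?_ (e j).2.1 (e j).2.2.1
        (e j).2.2.2)
      · rw [Set.sUnion_image, Set.biUnion_eq_iUnion]
        refine (mk_iUnion_le_sum_mk).trans_lt
          ((sum_le_sum _ (fun _ => ℵ₀) fun k => ?_).trans_lt ?_)
        · exact mk_le_aleph0_iff.2 (ih k.1 k.2).1.to_subtype
        · simp only [sum_const, lift_id]
          have h1 : #(Set.Iio j) < 2 ^ #Y := by
            refine lt_of_lt_of_le ?_ hT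
            simpa using mk_Iio_lt j (by simp)
          exact mul_lt_of_lt hY1 h1 (hY0.trans_lt (cantor _))
      · rintro F ⟨_, ⟨k, hk, rfl⟩, hF⟩
        exact ((ih k hk).2.1 F hF).1
  refine ⟨⋃ j, f j, ?_, ?_, ?_⟩
  · intro a ha
    obtain ⟨j, hj⟩ := Set.mem_iUnion.1 ha
    exact ((hf' j).2.1 a hj).2
  · intro a ha b hb hab
    obtain ⟨j, hj⟩ := Set.mem_iUnion.1 ha
    obtain ⟨k, hk⟩ := Set.mem_iUnion.1 hb
    rcases lt_trichotomy j k with h | rfl | h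
    · rw [Set.inter_comm]
      exact (hf' k).2.2.2.1 b hk a ⟨_, ⟨j, h, rfl⟩, hj⟩
    · exact (hf' j).2.2.1 hj hk hab
    · exact (hf' j).2.2.2.1 a hj b ⟨_, ⟨k, h, rfl⟩, hk⟩
  · intro u v hu hv huv
    obtain ⟨j, hj⟩ := e.surjective ⟨(u, v), hu, hv, huv⟩
    obtain ⟨a, ha, a', ha', h⟩ := (hf' j).2.2.2.2
    rw [hj] at h
    exact ⟨a, Set.mem_iUnion_of_mem j ha, a', Set.mem_iUnion_of_mem j ha', h⟩

open BooleanSubalgebra in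
lemma isAtom_inf_of_forall_generator {X C : Type} [BooleanAlgebra C] {G : Set (Set X)}
    {h : BoundedLatticeHom (closure G) C} (hh : Function.Surjective h) {c : C} (s : closure G)
    (hs : h s ⊓ c ≠ ⊥)
    (H : ∀ g : closure G, (g : Set X) ∈ G → h (s ⊓ g) ⊓ c = ⊥ ∨ h (s \ g) ⊓ c = ⊥) :
    IsAtom (h s ⊓ c) := by
  have key : ∀ g (hg : g ∈ closure G),
      h (s ⊓ ⟨g, hg⟩) ⊓ c = ⊥ ∨ h (s \ ⟨g, hg⟩) ⊓ c = ⊥ := by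
    intro g hg
    induction hg using closure_bot_sup_induction with
    | mem g hg => exact H ⟨g, subset_closure hg⟩ hg
    | bot =>
      left
      rw [mk_bot]
      simp
    | sup x hx y hy ihx ihy =>
      have e : (⟨x ⊔ y, (closure G).supClosed hx hy⟩ : closure G) = ⟨x, hx⟩ ⊔ ⟨y, hy⟩ := rfl
      rw [e]
      rcases ihx with ihx | ihx
      · rcases ihy with ihy | ihy
        · left
          rw [inf_sup_left, SupHomClass.map_sup, inf_sup_right, ihx, ihy, bot_sup_eq]
        · right
          refine eq_bot_mono (inf_le_inf_right c (OrderHomClass.mono h ?_)) ihy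
          exact sdiff_le_sdiff_left le_sup_right
      · right
        refine eq_bot_mono (inf_le_inf_right c (OrderHomClass.mono h ?_)) ihx
        exact sdiff_le_sdiff_left le_sup_left
    | compl x hx ihx =>
      have e : (⟨xᶜ, compl_mem hx⟩ : closure G) = ⟨x, hx⟩ᶜ := rfl
      rw [e, ← sdiff_eq, sdiff_compl]
      exact ihx.symm
  refine ⟨hs, fun y hy => ?_⟩
  obtain ⟨b, rfl⟩ := hh y
  rcases key b b.2 with hb | hb
  · rw [InfHomClass.map_inf, inf_right_comm, inf_eq_right.2 hy.le] at hb
    exact hb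
  · refine absurd ?_ hy.not_ge
    rw [sdiff_eq, InfHomClass.map_inf, map_compl', inf_right_comm, ← sdiff_eq,
      sdiff_eq_bot_iff] at hb
    exact hb

open BooleanSubalgebra in
theorem isAtomic_of_surjective {X ι : Type} {r : ι → ι → Prop} (hr : WellFounded r)
    {A : ι → Set X} (hA : ∀ i j, A i ⊆ A j ∨ ∃ k, r k i ∧ A i ∩ A j ⊆ A k)
    {𝒜 G : Set (Set X)} (hG : G = Set.range singleton ∪ 𝒜 ∪ Set.range A)
    (h𝒜 : ∀ a ∈ 𝒜, ∀ b ∈ closure G, (a ∩ b).Finite ∨ (a \ b).Finite)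
    {C : Type} [BooleanAlgebra C] (h : BoundedLatticeHom (closure G) C)
    (hh : Function.Surjective h) : IsAtomic C := by
  have hsing : ∀ x, {x} ∈ closure G := fun x => subset_closure (by simp [hG])
  have hmem𝒜 : ∀ a ∈ 𝒜, a ∈ closure G := fun a ha => subset_closure (by simp [hG, ha])
  have hmemA : ∀ i, A i ∈ closure G := fun i => subset_closure (by simp [hG])
  have hmono : ∀ {c : C} {s t : closure G}, (s : Set X) ⊆ t → h t ⊓ c = ⊥ → h s ⊓ c = ⊥ :=
    fun hst ht => eq_bot_mono (inf_le_inf_right _ (OrderHomClass.mono h hst)) ht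
  have hempty : ∀ {c : C} {s : closure G}, (s : Set X) = ∅ → h s ⊓ c = ⊥ := by
    intro c s hs
    have : s = ⊥ := Subtype.ext hs
    simp [this]
  refine ⟨fun c => or_iff_not_imp_left.2 fun hc => ?_⟩
  suffices ∃ s : closure G, h s ⊓ c ≠ ⊥ ∧
      ∀ g : closure G, (g : Set X) ∈ G → h (s ⊓ g) ⊓ c = ⊥ ∨ h (s \ g) ⊓ c = ⊥ by
    obtain ⟨s, hs, H⟩ := this
    exact ⟨_, isAtom_inf_of_forall_generator hh s hs H, inf_le_right⟩
  by_cases h1 : ∃ x, h ⟨{x}, hsing x⟩ ⊓ c ≠ ⊥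
  · obtain ⟨x, hx⟩ := h1
    refine ⟨_, hx, fun g _ => ?_⟩
    by_cases hxg : x ∈ (g : Set X)
    · exact Or.inr (hempty (Set.sdiff_eq_empty.2 (Set.singleton_subset_iff.2 hxg)))
    · exact Or.inl (hempty (by simp [hxg]))
  push Not at h1
  have hfin : ∀ s : closure G, (s : Set X).Finite → h s ⊓ c = ⊥ := by
    rintro ⟨s, hs⟩ (hsf : s.Finite)
    induction s, hsf using Set.Finite.induction_on with
    | empty => exact hempty rfl
    | @insert x s hxs hsf ih =>
      have hs' : s ∈ closure G := by
        have : s = insert x s \ {x} := by simp [hxs]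
        rw [this]
        exact sdiff_mem hs (hsing x)
      have e : (⟨insert x s, hs⟩ : closure G) = ⟨{x}, hsing x⟩ ⊔ ⟨s, hs'⟩ := rfl
      rw [e, SupHomClass.map_sup, inf_sup_right, ih hs', h1, bot_sup_eq]
  by_cases h2 : ∃ a, ∃ ha : a ∈ 𝒜, h ⟨a, hmem𝒜 a ha⟩ ⊓ c ≠ ⊥
  · obtain ⟨a, ha, hne⟩ := h2
    refine ⟨_, hne, fun g _ => ?_⟩
    exact (h𝒜 a ha g g.2).imp (hfin _) (hfin _)
  push Not at h2
  by_cases h3 : ∃ i, h ⟨A i, hmemA i⟩ ⊓ c ≠ ⊥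
  · obtain ⟨i, hi, hmin⟩ := hr.has_min {i | h ⟨A i, hmemA i⟩ ⊓ c ≠ ⊥} h3
    refine ⟨_, hi, ?_⟩
    rintro ⟨g, hgc⟩ (hg : g ∈ G)
    rw [hG] at hg
    rcases hg with (⟨x, rfl⟩ | hg) | ⟨j, rfl⟩
    · exact Or.inl (hmono Set.inter_subset_right (h1 x))
    · exact Or.inl (hmono Set.inter_subset_right (h2 g hg))
    · rcases hA i j with hij | ⟨k, hk, hij⟩
      · exact Or.inr (hempty (Set.sdiff_eq_empty.2 hij))
      · refine Or.inl (hmono (t := ⟨A k, hmemA k⟩) hij ?_)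
        by_contra hne
        exact hmin k hne hk
  push Not at h3
  refine ⟨⊤, by simpa using hc, ?_⟩
  rintro ⟨g, hgc⟩ (hg : g ∈ G)
  rw [hG] at hg
  left
  rw [top_inf_eq]
  rcases hg with (⟨x, rfl⟩ | hg) | ⟨j, rfl⟩
  · exact h1 x
  · exact h2 g hg
  · exact h3 j

lemma inter_finite_or_diff_finite_of_mem_closure {X : Type} {a : Set X} {G : Set (Set X)}
    (h : ∀ g ∈ G, (a ∩ g).Finite ∨ (a \ g).Finite) {b : Set X}
    (hb : b ∈ BooleanSubalgebra.closure G) : (a ∩ b).Finite ∨ (a \ b).Finite := by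
  induction hb using BooleanSubalgebra.closure_bot_sup_induction with
  | mem g hg => exact h g hg
  | bot => simp
  | sup x hx y hy ihx ihy =>
    rcases ihx with ihx | ihx
    · rcases ihy with ihy | ihy
      · left
        change (a ∩ (x ∪ y)).Finite
        rw [Set.inter_union_distrib_left]
        exact ihx.union ihy
      · exact Or.inr (ihy.subset (Set.sdiff_subset_sdiff_right Set.subset_union_right))
    · exact Or.inr (ihx.subset (Set.sdiff_subset_sdiff_right Set.subset_union_left))
  | compl x hx ihx =>
    rw [← Set.sdiff_eq, sdiff_compl]
    exact ihx.symm

lemma exists_perm_of_orderIso_s4 {X : Type} {L : BooleanSubalgebra (Set X)}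
    (hL : ∀ x, {x} ∈ L) (φ : L ≃o L) :
    ∃ π : Equiv.Perm X, ∀ b : L, (φ b : Set X) = π '' b := by
  have hatom : ∀ x, IsAtom (⟨{x}, hL x⟩ : L) := by
    refine fun x => ⟨fun h => ?_, fun b hb => ?_⟩
    · exact Set.singleton_ne_empty x (congrArg Subtype.val h)
    · have : (b : Set X) < {x} := hb
      exact Subtype.ext (Set.ssubset_singleton_iff.1 this)
  have hatom' : ∀ b : L, IsAtom b → ∃ x, b = ⟨{x}, hL x⟩ := by
    intro b hb
    have hne : (b : Set X).Nonempty := by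
      rw [Set.nonempty_iff_ne_empty]
      exact fun h => hb.1 (Subtype.ext h)
    obtain ⟨x, hx⟩ := hne
    have hle : (⟨{x}, hL x⟩ : L) ≤ b := Set.singleton_subset_iff.2 hx
    exact ⟨x, ((hb.le_iff.1 hle).resolve_left (hatom x).1).symm⟩
  have hex : ∀ (ψ : L ≃o L) x, ∃ y, ψ ⟨{x}, hL x⟩ = ⟨{y}, hL y⟩ := fun ψ x =>
    hatom' _ ((OrderIso.isAtom_iff ψ _).2 (hatom x))
  choose f hf using hex
  have hinj : ∀ x y, (⟨{x}, hL x⟩ : L) = ⟨{y}, hL y⟩ → x = y := fun x y h =>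
    Set.singleton_injective (congrArg Subtype.val h)
  let π : Equiv.Perm X := ⟨f φ, f φ.symm,
    fun x => hinj _ _ (by rw [← hf, ← hf, OrderIso.symm_apply_apply]),
    fun x => hinj _ _ (by rw [← hf, ← hf, OrderIso.apply_symm_apply])⟩
  refine ⟨π, fun b => Set.ext fun y => ?_⟩
  obtain ⟨x, rfl⟩ := π.surjective y
  rw [π.injective.mem_set_image]
  have h1 : (⟨{π x}, hL _⟩ : L) ≤ φ b ↔ (⟨{x}, hL x⟩ : L) ≤ b := by
    rw [show (⟨{π x}, hL _⟩ : L) = φ ⟨{x}, hL x⟩ from (hf φ x).symm, φ.le_iff_le]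
  simpa [← Subtype.coe_le_coe] using h1

lemma exists_disjoint_image {X : Type} (π : Equiv.Perm X) :
    ∃ M : Set X, Disjoint M (π '' M) ∧ {x | π x ≠ x} ⊆ M ∪ π '' M ∪ π.symm '' M := by
  obtain ⟨M, hM⟩ := zorn_subset {M : Set X | ∀ x ∈ M, π x ∉ M} (by
    intro c hc hchain
    refine ⟨⋃₀ c, ?_, fun s hs => Set.subset_sUnion_of_mem hs⟩
    rintro x ⟨s, hs, hx⟩ ⟨t, ht, hxt⟩
    rcases hchain.total hs ht with h | h
    · exact hc ht x (h hx) hxt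
    · exact hc hs x hx (h hxt))
  have hMp : ∀ x ∈ M, π x ∉ M := hM.prop
  refine ⟨M, ?_, ?_⟩
  · rw [Set.disjoint_right]
    rintro _ ⟨x, hx, rfl⟩
    exact hMp x hx
  · intro x hx
    by_contra H
    simp only [Set.mem_union, not_or] at H
    obtain ⟨⟨h1, h2⟩, h3⟩ := H
    have h3' : π x ∉ M := fun h => h3 ⟨π x, h, by simp⟩
    refine h1 (hM.le_of_ge (y := insert x M) ?_ (Set.subset_insert _ _) (Set.mem_insert _ _))
    rintro y (rfl | hy) (h | h)
    · exact hx h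
    · exact h3' h
    · exact h2 ⟨y, hy, h⟩
    · exact hMp y hy h

lemma mk_support_le {X Y : Type} (hY : ℵ₀ ≤ #Y) {𝒜 : Set (Set X)}
    {L : BooleanSubalgebra (Set X)} (h𝒜L : ∀ a ∈ 𝒜, a ∈ L)
    (h𝒜 : ∀ a ∈ 𝒜, ∀ b ∈ L, (a ∩ b).Finite ∨ (a \ b).Finite)
    (hsp : ∀ u v : Y → X, Function.Injective u → Function.Injective v →
      Disjoint (Set.range u) (Set.range v) → Spoils u v 𝒜)
    (φ : L ≃o L) (π : Equiv.Perm X) (hπ : ∀ b : L, (φ b : Set X) = π '' b) :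
    #{x | π x ≠ x} ≤ #Y := by
  by_contra! hlt
  obtain ⟨M, hdisj, hM⟩ := exists_disjoint_image π
  have hMY : #Y ≤ #M := by
    by_contra! h
    refine hlt.not_ge ((mk_le_mk_of_subset hM).trans (((mk_union_le _ _).trans_lt
      (add_lt_of_lt hY ((mk_union_le _ _).trans_lt (add_lt_of_lt hY h ?_)) ?_)).le))
    · exact mk_image_le.trans_lt h
    · exact mk_image_le.trans_lt h
  obtain ⟨u⟩ := hMY
  have hsub : Set.range (fun y => (u y : X)) ⊆ M := by
    rintro _ ⟨y, rfl⟩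
    exact (u y).2
  have hu : Function.Injective fun y => (u y : X) := Subtype.val_injective.comp u.injective
  obtain ⟨a, ha, a', ha', hau, hinf, haa', hdiff⟩ := hsp (fun y => (u y : X))
    (fun y => π (u y)) hu (π.injective.comp hu) (by
      refine hdisj.mono hsub ?_
      rintro _ ⟨y, rfl⟩
      exact ⟨_, (u y).2, rfl⟩)
  have himg : (fun y => π (u y)) '' ((fun y => (u y : X)) ⁻¹' a) = π '' a := by
    rw [show (fun y => π (u y)) = π ∘ (fun y => (u y : X)) from rfl, Set.image_comp,
      Set.image_preimage_eq_of_subset hau]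
  rw [himg] at haa' hdiff
  have hb : π '' (φ.symm ⟨a', h𝒜L a' ha'⟩ : L) = a' := by
    rw [← hπ, OrderIso.apply_symm_apply]
  rcases h𝒜 a ha _ (φ.symm ⟨a', h𝒜L a' ha'⟩).2 with h | h
  · refine hinf ?_
    have := h.image π
    rw [Set.image_inter π.injective, hb, Set.inter_eq_right.2 haa'] at this
    exact this
  · refine hdiff ?_
    have := h.image π
    rw [Set.image_sdiff π.injective, hb] at this
    exact this

theorem mk_orderIso_le {X Y : Type} (hY : ℵ₀ ≤ #Y) (hX : #X ≤ 2 ^ #Y) {𝒜 : Set (Set X)}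
    {L : BooleanSubalgebra (Set X)} (hL : ∀ x, {x} ∈ L) (h𝒜L : ∀ a ∈ 𝒜, a ∈ L)
    (h𝒜 : ∀ a ∈ 𝒜, ∀ b ∈ L, (a ∩ b).Finite ∨ (a \ b).Finite)
    (hsp : ∀ u v : Y → X, Function.Injective u → Function.Injective v →
      Disjoint (Set.range u) (Set.range v) → Spoils u v 𝒜) :
    #(L ≃o L) ≤ 2 ^ #Y := by
  choose π hπ using exists_perm_of_orderIso_s4 hL
  have hY1 : ℵ₀ ≤ 2 ^ #Y := hY.trans (cantor _).le
  have hgraph : ∀ φ, #((fun x => (x, π φ x)) '' {x | π φ x ≠ x}) ≤ #Y := fun φ =>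
    mk_image_le.trans (mk_support_le hY h𝒜L h𝒜 hsp φ (π φ) (hπ φ))
  have hle : #(L ≃o L) ≤ #{t : Set (X × X) // #t ≤ #Y} := by
    refine ⟨⟨fun φ => ⟨_, hgraph φ⟩, fun φ ψ h => ?_⟩⟩
    have hg := Set.ext_iff.1 (congrArg Subtype.val h)
    simp only [Set.mem_image, Prod.forall, Prod.mk.injEq] at hg
    have hπeq : ∀ x, π φ x = π ψ x := by
      intro x
      have h1 := hg x (π φ x)
      have h2 := hg x (π ψ x)
      by_contra hne
      by_cases hx : π φ x = x
      · have h3 : π ψ x ≠ x := fun h => hne (hx.trans h.symm)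
        obtain ⟨y, hy, rfl, hy'⟩ := h2.2 ⟨x, h3, rfl, rfl⟩
        exact hne hy'
      · obtain ⟨y, hy, rfl, hy'⟩ := h1.1 ⟨x, hx, rfl, rfl⟩
        exact hne hy'.symm
    refine OrderIso.ext (funext fun b => Subtype.ext ?_)
    rw [hπ, hπ, Equiv.ext hπeq]
  refine hle.trans ((mk_bounded_set_le _ _).trans ?_)
  have : max #(X × X) ℵ₀ ≤ 2 ^ #Y := by
    refine max_le ?_ hY1
    rw [mk_prod]
    simp only [lift_id]
    exact mul_le_of_le hY1 hX hX
  refine (power_le_power_right this).trans ?_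
  rw [← power_mul, mul_eq_self hY]

/-- There is a superatomic Boolean algebra with fewer automorphisms than elements. -/
theorem exists_superatomic_aut_lt_card :
    ∃ (B : Type) (_ : BooleanAlgebra B), Superatomic B ∧ #(B ≃o B) < #B := by
  obtain ⟨Y, I, D, hY, hI, hinf, hcount, hD⟩ := exists_almostDisjoint_family
  have hY0 : ℵ₀ ≤ #Y := (cantor ℵ₀).le.trans hY
  obtain ⟨X, ι, r, A, hr, hX, hμ, hA⟩ := exists_tree_family (2 ^ #Y) (hY0.trans (cantor _).le)
  obtain ⟨𝒜, hhom, had, hsp⟩ := exists_spoiling_family hr hA hY hI hinf hcount hD hX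
  let G : Set (Set X) := Set.range singleton ∪ 𝒜 ∪ Set.range A
  have hsplit : ∀ a ∈ 𝒜, ∀ b ∈ BooleanSubalgebra.closure G, (a ∩ b).Finite ∨ (a \ b).Finite := by
    refine fun a ha b hb => inter_finite_or_diff_finite_of_mem_closure ?_ hb
    rintro g ((⟨x, rfl⟩ | hg) | ⟨i, rfl⟩)
    · exact Or.inl ((Set.finite_singleton x).subset Set.inter_subset_right)
    · by_cases hag : a = g
      · right
        simp [hag]
      · exact Or.inl (had ha hg hag)
    · exact hhom a ha i
  have hsub : G ⊆ BooleanSubalgebra.closure G := BooleanSubalgebra.subset_closure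
  refine ⟨BooleanSubalgebra.closure G, inferInstance, ?_, ?_⟩
  · intro C _ h hh
    exact isAtomic_of_surjective hr hA rfl hsplit h hh
  · refine (mk_orderIso_le hY0 hX (fun x => hsub (by simp [G])) (fun a ha => hsub (by simp [G, ha]))
      hsplit hsp).trans_lt (hμ.trans_le ?_)
    exact mk_le_mk_of_subset (Set.subset_union_right.trans hsub)
end

section
/- Let μ be a strong limit singular cardinal with cf(μ) = ℵ₀, let λ = 2^μ, and let κ be the least cardinal with 2^κ > λ. Then there is a superatomic Boolean algebra B with |B| = 2^κ, |Atom(B)| = 2^{<κ} + μ, and 2^{<κ} + μ ≤ |Aut(B)| ≤ λ; in particular |Aut(B)| < |B|. -/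
open Cardinal

open Set Filter

/-- A Boolean algebra is superatomic as soon as every quotient by a proper ideal has an atom. -/
theorem superatomic_of_forall_ideal {B : Type} [BooleanAlgebra B]
    (H : ∀ I : Order.Ideal B, ⊤ ∉ I → ∃ g ∉ I, ∀ x, g ⊓ x ∈ I ∨ g \ x ∈ I) :
    Superatomic B := by
  intro C _ h hsurj
  refine ⟨fun y => ?_⟩
  obtain ⟨b, rfl⟩ := hsurj y
  refine or_iff_not_imp_left.2 fun hb => ?_
  let I : Order.Ideal B :=
    { carrier := {x | h (x ⊓ b) = ⊥}
      lower' := fun x y hyx hx => by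
        have : h (y ⊓ b) ≤ h (x ⊓ b) := OrderHomClass.mono h (inf_le_inf_right b hyx)
        exact le_bot_iff.1 (this.trans_eq hx)
      nonempty' := ⟨⊥, by simp⟩
      directed' := fun x hx y hy => ⟨x ⊔ y, by
        change h ((x ⊔ y) ⊓ b) = ⊥
        rw [inf_sup_right, SupHomClass.map_sup, hx, hy, sup_bot_eq], le_sup_left, le_sup_right⟩ }
  have hI : ∀ x, x ∈ I ↔ h (x ⊓ b) = ⊥ := fun x => Iff.rfl
  obtain ⟨g, hg, hgx⟩ := H I (by rwa [hI, top_inf_eq])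
  refine ⟨h (g ⊓ b), ⟨hg, fun z hz => ?_⟩, OrderHomClass.mono h inf_le_right⟩
  obtain ⟨x, rfl⟩ := hsurj z
  rcases hgx x with hx | hx
  · rw [hI, inf_right_comm, InfHomClass.map_inf, inf_eq_right.2 hz.le] at hx
    exact hx
  · refine absurd ?_ hz.not_ge
    rw [hI, inf_comm, ← inf_sdiff_assoc, map_sdiff', sdiff_eq_bot_iff, inf_comm] at hx
    exact hx

/-- A Boolean subalgebra generated by at most `c` elements has at most `c` elements, for infinite
`c`. -/
theorem mk_booleanSubalgebra_closure_le {α : Type} [BooleanAlgebra α] (G : Set α) {c : Cardinal}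
    (hc : ℵ₀ ≤ c) (hG : #G ≤ c) : #(BooleanSubalgebra.closure G) ≤ c := by
  let S : ℕ → Set α := fun n =>
    Nat.rec (insert ⊥ G) (fun _ s => s ∪ image2 (fun x y => (x ⊔ y)ᶜ) s s) n
  have hS : ∀ n, S (n + 1) = S n ∪ image2 (fun x y => (x ⊔ y)ᶜ) (S n) (S n) := fun _ => rfl
  have hmono : Monotone S := monotone_nat_of_le_succ fun n => by
    rw [hS]; exact subset_union_left
  have hcard : ∀ n, #(↥(S n)) ≤ c := by
    intro n
    induction n with
    | zero =>
      exact (mk_insert_le).trans (add_le_of_le hc hG (one_le_aleph0.trans hc))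
    | succ n ih =>
      rw [hS]
      refine (mk_union_le _ _).trans (add_le_of_le hc ih ?_)
      rw [← image_uncurry_prod]
      refine mk_image_le.trans ?_
      rw [mk_setProd]
      exact mul_le_of_le hc ih ih
  have hsub : ∀ x ∈ BooleanSubalgebra.closure G, x ∈ ⋃ n, S n := by
    intro x hx
    have hnand : ∀ y ∈ ⋃ n, S n, ∀ z ∈ ⋃ n, S n, (y ⊔ z)ᶜ ∈ ⋃ n, S n := by
      simp only [mem_iUnion]
      rintro y ⟨m, hm⟩ z ⟨n, hn⟩
      refine ⟨max m n + 1, ?_⟩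
      rw [hS]
      exact Or.inr ⟨y, hmono (le_max_left m n) hm, z, hmono (le_max_right m n) hn, rfl⟩
    have hcompl : ∀ y ∈ ⋃ n, S n, yᶜ ∈ ⋃ n, S n := fun y hy => by
      simpa using hnand y hy y hy
    induction hx using BooleanSubalgebra.closure_bot_sup_induction with
    | mem x hx => exact mem_iUnion.2 ⟨0, Or.inr hx⟩
    | bot => exact mem_iUnion.2 ⟨0, Or.inl rfl⟩
    | sup x _ y _ hx hy => simpa using hcompl _ (hnand x hx y hy)
    | compl x _ hx => exact hcompl x hx
  calc #(BooleanSubalgebra.closure G) ≤ #(↥(⋃ n, S n)) := mk_le_mk_of_subset hsub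
    _ ≤ #ℕ * ⨆ n, #(↥(S n)) := by simpa using mk_iUnion_le_lift S
    _ ≤ c := mul_le_of_le hc (by simpa using hc) (ciSup_le' hcard)

/-- In a generated subalgebra, it suffices to check on generators that an element is not split
modulo an ideal. -/
theorem inf_mem_or_sdiff_mem_of_closure {α : Type} [BooleanAlgebra α] {G : Set α}
    (I : Order.Ideal (BooleanSubalgebra.closure G)) (g : BooleanSubalgebra.closure G)
    (h : ∀ (x : α) (hx : x ∈ G), g ⊓ ⟨x, BooleanSubalgebra.subset_closure hx⟩ ∈ I ∨
      g \ ⟨x, BooleanSubalgebra.subset_closure hx⟩ ∈ I)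
    (x : BooleanSubalgebra.closure G) : g ⊓ x ∈ I ∨ g \ x ∈ I := by
  obtain ⟨x, hx⟩ := x
  induction hx using BooleanSubalgebra.closure_bot_sup_induction with
  | mem x hx => exact h x hx
  | bot =>
    rw [BooleanSubalgebra.mk_bot, inf_bot_eq]
    exact Or.inl I.bot_mem
  | sup x hx y hy ihx ihy =>
    rw [← BooleanSubalgebra.mk_sup_mk x y hx hy]
    rcases ihx with ihx | ihx
    · rcases ihy with ihy | ihy
      · left
        rw [inf_sup_left]
        exact Order.Ideal.sup_mem ihx ihy
      · exact Or.inr (I.lower (sdiff_le_sdiff_left le_sup_right) ihy)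
    · exact Or.inr (I.lower (sdiff_le_sdiff_left le_sup_left) ihx)
  | compl x hx ih =>
    rw [← BooleanSubalgebra.compl_mk x hx, ← _root_.sdiff_eq, _root_.sdiff_eq (y := _ᶜ), compl_compl]
    exact ih.symm

/-- The sequence `s` is eventually inside or eventually outside of `b`. -/
def Unsplit {T : Type} (s : ℕ → T) (b : Set T) : Prop :=
  (∀ᶠ n in atTop, s n ∈ b) ∨ ∀ᶠ n in atTop, s n ∉ b

theorem Unsplit.comp {T : Type} {s : ℕ → T} {b : Set T} (h : Unsplit s b) {φ : ℕ → ℕ}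
    (hφ : StrictMono φ) : Unsplit (s ∘ φ) b :=
  h.imp hφ.tendsto_atTop.eventually hφ.tendsto_atTop.eventually

theorem unsplit_of_finite {T : Type} {s : ℕ → T} {b : Set T} (h : {n | s n ∈ b}.Finite) :
    Unsplit s b := by
  right
  rw [← Nat.cofinite_eq_atTop]
  exact h.eventually_cofinite_notMem

theorem Unsplit.of_closure {T : Type} {s : ℕ → T} {G : Set (Set T)} (h : ∀ b ∈ G, Unsplit s b)
    {b : Set T} (hb : b ∈ BooleanSubalgebra.closure G) : Unsplit s b := by
  induction hb using BooleanSubalgebra.closure_bot_sup_induction with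
  | mem x hx => exact h x hx
  | bot => exact Or.inr (Eventually.of_forall fun n => notMem_empty _)
  | sup x _ y _ hx hy =>
    rcases hx with hx | hx
    · exact Or.inl (hx.mono fun n hn => Or.inl hn)
    · rcases hy with hy | hy
      · exact Or.inl (hy.mono fun n hn => Or.inr hn)
      · exact Or.inr ((hx.and hy).mono fun n hn h => h.elim hn.1 hn.2)
  | compl x _ hx =>
    exact hx.symm.imp id fun h => h.mono fun n hn h' => h' hn

/-- Initial segments of branches, where `seg X ⊤` is the full branch. -/
structure BranchSystem (T X W : Type) [LinearOrder W] [OrderTop W] where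
  /-- The initial segment of the branch `x` below `w`. -/
  seg : X → W → Set T
  subset_or_inter : ∀ x w y, seg x w ⊆ seg y ⊤ ∨ ∃ w' < w, seg x w ∩ seg y ⊤ = seg x w'

namespace BranchSystem

variable {T X W : Type} [LinearOrder W] [OrderTop W] (S : BranchSystem T X W)

/-- If some branch fails `P`, there is a segment failing `P` that the branches do not split
modulo `P`. -/
theorem exists_minimal [WellFoundedLT W] (P : Set T → Prop) {x : X} (hx : ¬ P (S.seg x ⊤)) :
    ∃ x w, ¬ P (S.seg x w) ∧ ∀ y, S.seg x w ⊆ S.seg y ⊤ ∨ P (S.seg x w ∩ S.seg y ⊤) := by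
  obtain ⟨w, ⟨x, hw⟩, hmin⟩ :=
    wellFounded_lt.has_min {w : W | ∃ x, ¬ P (S.seg x w)} ⟨⊤, x, hx⟩
  refine ⟨x, w, hw, fun y => (S.subset_or_inter x w y).imp_right ?_⟩
  rintro ⟨w', hw', heq⟩
  rw [heq]
  by_contra hP
  exact hmin w' ⟨x, hP⟩ hw'

/-- Every sequence has a subsequence which no branch splits. -/
theorem exists_subseq_unsplit [WellFoundedLT W] (s : ℕ → T) :
    ∃ φ : ℕ → ℕ, StrictMono φ ∧ ∀ y, Unsplit (s ∘ φ) (S.seg y ⊤) := by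
  by_cases h : ∀ x, {n | s n ∈ S.seg x ⊤}.Finite
  · exact ⟨id, strictMono_id, fun y => unsplit_of_finite (h y)⟩
  · push Not at h
    obtain ⟨x, hx⟩ := h
    obtain ⟨x, w, hw, hmin⟩ := S.exists_minimal (fun b => {n | s n ∈ b}.Finite) (x := x) hx
    obtain ⟨φ, hφ, hmem⟩ := extraction_of_frequently_atTop (P := fun n => s n ∈ S.seg x w)
      (by rwa [← Nat.cofinite_eq_atTop, frequently_cofinite_iff_infinite])
    refine ⟨φ, hφ, fun y => (hmin y).elim ?_ ?_⟩
    · intro hsub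
      exact Or.inl (Eventually.of_forall fun n => hsub (hmem n))
    · intro hfin
      refine unsplit_of_finite ((hfin.preimage hφ.injective.injOn).subset ?_)
      intro n hn
      exact ⟨hmem n, hn⟩

/-- The generators: singletons, the ranges of the sequences `a d`, and the branches. -/
def generators {D : Type} (a : D → ℕ → T) : Set (Set T) :=
  range singleton ∪ (range fun d => range (a d)) ∪ range fun x => S.seg x ⊤

/-- The algebra of sets generated by singletons, the ranges of the sequences `a d`, and the
branches. -/
abbrev algebra {D : Type} (a : D → ℕ → T) : BooleanSubalgebra (Set T) :=
  BooleanSubalgebra.closure (S.generators a)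

variable {D : Type} {a : D → ℕ → T}

theorem singleton_mem_algebra (t : T) : {t} ∈ S.algebra a :=
  BooleanSubalgebra.subset_closure (Or.inl (Or.inl ⟨t, rfl⟩))

theorem range_mem_algebra (d : D) : range (a d) ∈ S.algebra a :=
  BooleanSubalgebra.subset_closure (Or.inl (Or.inr ⟨d, rfl⟩))

theorem seg_mem_algebra (x : X) : S.seg x ⊤ ∈ S.algebra a :=
  BooleanSubalgebra.subset_closure (Or.inr ⟨x, rfl⟩)

theorem finite_mem_algebra {s : Set T} (hs : s.Finite) : s ∈ S.algebra a := by
  induction s, hs using Set.Finite.induction_on with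
  | empty => exact BooleanSubalgebra.bot_mem
  | insert _ _ ih => exact BooleanSubalgebra.sup_mem (S.singleton_mem_algebra _) ih

theorem superatomic_algebra [WellFoundedLT W] (hun : ∀ d, ∀ b ∈ S.algebra a, Unsplit (a d) b) : Superatomic (S.algebra a) := by
  refine superatomic_of_forall_ideal fun I hI => ?_
  by_cases h₁ : ∀ t, (⟨{t}, S.singleton_mem_algebra t⟩ : S.algebra a) ∈ I
  swap
  · push Not at h₁
    obtain ⟨t, ht⟩ := h₁
    refine ⟨_, ht, fun ⟨b, hb⟩ => ?_⟩
    by_cases htb : t ∈ b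
    · right
      convert I.bot_mem
      exact Subtype.ext (sdiff_eq_empty.2 (singleton_subset_iff.2 htb))
    · left
      convert I.bot_mem
      exact Subtype.ext (singleton_inter_eq_empty.2 htb)
  have hfin : ∀ (s : Set T) (hs : s.Finite) (hs' : s ∈ S.algebra a), ⟨s, hs'⟩ ∈ I := by
    intro s hs
    induction s, hs using Set.Finite.induction_on with
    | empty => exact fun _ => I.bot_mem
    | insert _ hs ih =>
      exact fun _ => Order.Ideal.sup_mem (h₁ _) (ih (S.finite_mem_algebra hs))
  by_cases h₂ : ∀ d, (⟨range (a d), S.range_mem_algebra d⟩ : S.algebra a) ∈ I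
  swap
  · push Not at h₂
    obtain ⟨d, hd⟩ := h₂
    refine ⟨_, hd, fun ⟨b, hb⟩ => ?_⟩
    rcases hun d b hb with h | h
    · right
      refine hfin _ ?_ _
      rw [← Nat.cofinite_eq_atTop] at h
      refine ((show {n | a d n ∉ b}.Finite from h).image (a d)).subset ?_
      rintro _ ⟨⟨n, rfl⟩, hn⟩
      exact ⟨n, hn, rfl⟩
    · left
      refine hfin _ ?_ _
      rw [← Nat.cofinite_eq_atTop] at h
      refine ((show {n | ¬ a d n ∉ b}.Finite from h).image (a d)).subset ?_
      rintro _ ⟨⟨n, rfl⟩, hn⟩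
      exact ⟨n, not_not.2 hn, rfl⟩
  by_cases h₃ : ∀ x, (⟨S.seg x ⊤, S.seg_mem_algebra x⟩ : S.algebra a) ∈ I
  swap
  · push Not at h₃
    obtain ⟨x, hx⟩ := h₃
    obtain ⟨x, w, hw, hmin⟩ := S.exists_minimal
      (fun b => ∀ hb : b ∈ S.algebra a, (⟨b, hb⟩ : S.algebra a) ∈ I) (x := x) fun h => hx (h _)
    push Not at hw
    obtain ⟨hmem, hw⟩ := hw
    refine ⟨_, hw, inf_mem_or_sdiff_mem_of_closure I _ ?_⟩
    rintro _ ((⟨t, rfl⟩ | ⟨d, rfl⟩) | ⟨y, rfl⟩)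
    · exact Or.inl (I.lower inf_le_right (h₁ t))
    · exact Or.inl (I.lower inf_le_right (h₂ d))
    · rcases hmin y with h | h
      · right
        convert I.bot_mem
        exact Subtype.ext (sdiff_eq_empty.2 h)
      · exact Or.inl (h _)
  refine ⟨⊤, hI, inf_mem_or_sdiff_mem_of_closure I _ ?_⟩
  rintro _ ((⟨t, rfl⟩ | ⟨d, rfl⟩) | ⟨y, rfl⟩)
  · exact Or.inl (I.lower inf_le_right (h₁ t))
  · exact Or.inl (I.lower inf_le_right (h₂ d))
  · exact Or.inl (I.lower inf_le_right (h₃ y))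

end BranchSystem

/-- A family of injective sequences with pairwise almost disjoint ranges. -/
structure AlmostDisjointFamily (L M : Type) where
  /-- The sequences. -/
  seq : L → ℕ → M
  injective : ∀ l, Function.Injective (seq l)
  finite : ∀ l l', l ≠ l' → {n | seq l n ∈ range (seq l')}.Finite

/-- Fewer than `#L` countable sets cannot meet all sequences of an almost disjoint family
indexed by `L` in infinite sets. -/
theorem AlmostDisjointFamily.exists_forall_finite {L M J : Type} (C : AlmostDisjointFamily L M)
    (hL : 𝔠 < #L) (hJ : #J < #L) (V : J → Set M) (hV : ∀ j, (V j).Countable) :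
    ∃ l, ∀ j, {n | C.seq l n ∈ V j}.Finite := by
  by_contra! h
  choose j hj using h
  have hinj : Function.Injective
      fun l => (⟨j l, {v | (v : M) ∈ range (C.seq l)}⟩ : Σ j, Set (V j)) := by
    intro l l' hll
    by_contra hne
    refine hj l ((C.finite l l' hne).subset fun n hn => ?_)
    obtain ⟨h₁, h₂⟩ := Sigma.mk.inj_iff.1 hll
    have key : ∀ (i i' : J) (hi : i = i') (A : Set (V i)) (A' : Set (V i')), A ≍ A' →
        ∀ m (hm : m ∈ V i), (⟨m, hm⟩ : V i) ∈ A → ∃ hm' : m ∈ V i', (⟨m, hm'⟩ : V i') ∈ A' := by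
      rintro i _ rfl A A' hA m hm hmA
      exact ⟨hm, eq_of_heq hA ▸ hmA⟩
    exact (key _ _ h₁ _ _ h₂ (C.seq l n) hn ⟨n, rfl⟩).2
  have hle := mk_le_of_injective hinj
  rw [mk_sigma] at hle
  have hsum : Cardinal.sum (fun i => #(Set (V i))) ≤ #J * 𝔠 := by
    rw [← sum_const']
    refine sum_le_sum _ _ fun i => ?_
    rw [mk_set, ← two_power_aleph0]
    exact power_le_power_left two_ne_zero (le_aleph0_iff_set_countable.2 (hV i))
  exact (hle.trans hsum).not_gt
    (mul_lt_of_lt (aleph0_le_continuum.trans hL.le) hJ hL)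

/-- Pairs of injections with disjoint ranges. -/
abbrev InjPair (M T : Type) : Type :=
  {p : (M → T) × (M → T) // Function.Injective p.1 ∧ Function.Injective p.2 ∧
    ∀ m m', p.1 m ≠ p.2 m'}

theorem mk_injPair_le {M T : Type} {c : Cardinal} (hc : ℵ₀ ≤ c) (h : #T ^ #M ≤ c) :
    #(InjPair M T) ≤ c := by
  refine (mk_subtype_le _).trans ?_
  rw [← mul_def, ← power_def]
  exact mul_le_of_le hc h h

namespace BranchSystem

variable {T X W : Type} [LinearOrder W] [OrderTop W] [WellFoundedLT W] (S : BranchSystem T X W)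

theorem exists_good_seq {L M J : Type} (C : AlmostDisjointFamily L M)
    (hL : 𝔠 < #L) (hJ : #J < #L) {e f : M → T} (he : Function.Injective e)
    (hf : Function.Injective f) (U : J → Set T) (hU : ∀ j, (U j).Countable) :
    ∃ c : ℕ → M, Function.Injective c ∧
      (∀ j, {n | e (c n) ∈ U j}.Finite ∧ {n | f (c n) ∈ U j}.Finite) ∧
      ∀ y, Unsplit (e ∘ c) (S.seg y ⊤) ∧ Unsplit (f ∘ c) (S.seg y ⊤) := by
  obtain ⟨l, hl⟩ := C.exists_forall_finite hL hJ (fun j => e ⁻¹' U j ∪ f ⁻¹' U j)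
    fun j => ((hU j).preimage he).union ((hU j).preimage hf)
  obtain ⟨φ, hφ, hφe⟩ := S.exists_subseq_unsplit (e ∘ C.seq l)
  obtain ⟨ψ, hψ, hψf⟩ := S.exists_subseq_unsplit (f ∘ C.seq l ∘ φ)
  have hinj := (hφ.comp hψ).injective
  refine ⟨C.seq l ∘ φ ∘ ψ, (C.injective l).comp hinj, fun j => ⟨?_, ?_⟩,
    fun y => ⟨(hφe y).comp hψ, hψf y⟩⟩
  · exact ((hl j).preimage hinj.injOn).subset fun n hn => Or.inl hn
  · exact ((hl j).preimage hinj.injOn).subset fun n hn => Or.inr hn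

theorem exists_good_family {L M : Type} (C : AlmostDisjointFamily L M) (hL : 𝔠 < #L)
    (hD : #(InjPair M T) ≤ #L) :
    ∃ c : InjPair M T → ℕ → M, (∀ d, Function.Injective (c d)) ∧
      (∀ d d', d ≠ d' → {n | d.1.1 (c d n) ∈ range (d'.1.2 ∘ c d')}.Finite ∧
        {n | d.1.2 (c d n) ∈ range (d'.1.2 ∘ c d')}.Finite) ∧
      ∀ d y, Unsplit (d.1.1 ∘ c d) (S.seg y ⊤) ∧ Unsplit (d.1.2 ∘ c d) (S.seg y ⊤) := by
  obtain ⟨_, _, hord⟩ := exists_ord_eq_type_lt (InjPair M T)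
  have step : ∀ (d : InjPair M T) (prev : ∀ d' < d, ℕ → M), ∃ c : ℕ → M,
      Function.Injective c ∧
      (∀ j : Iio d, {n | d.1.1 (c n) ∈
          range (j.1.1.1 ∘ prev j j.2) ∪ range (j.1.1.2 ∘ prev j j.2)}.Finite ∧
        {n | d.1.2 (c n) ∈
          range (j.1.1.1 ∘ prev j j.2) ∪ range (j.1.1.2 ∘ prev j j.2)}.Finite) ∧
      ∀ y, Unsplit (d.1.1 ∘ c) (S.seg y ⊤) ∧ Unsplit (d.1.2 ∘ c) (S.seg y ⊤) :=
    fun d prev => S.exists_good_seq C hL ((mk_Iio_lt d hord).trans_le hD) d.2.1 d.2.2.1 _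
      fun j => (countable_range _).union (countable_range _)
  choose F hF₁ hF₂ hF₃ using step
  let c : InjPair M T → ℕ → M := wellFounded_lt.fix F
  have hc : ∀ d, c d = F d fun d' _ => c d' := fun d => wellFounded_lt.fix_eq F d
  have hinj : ∀ d, Function.Injective (c d) := fun d => by rw [hc]; exact hF₁ _ _
  have hlt : ∀ d d', d' < d →
      {n | d.1.1 (c d n) ∈ range (d'.1.1 ∘ c d') ∪ range (d'.1.2 ∘ c d')}.Finite ∧
      {n | d.1.2 (c d n) ∈ range (d'.1.1 ∘ c d') ∪ range (d'.1.2 ∘ c d')}.Finite := by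
    intro d d' hd
    rw [hc d]
    exact hF₂ d (fun d' _ => c d') ⟨d', hd⟩
  have hflip : ∀ s s' : ℕ → T, Function.Injective s → {n | s n ∈ range s'}.Finite →
      Function.Injective s' → {n | s' n ∈ range s}.Finite := by
    intro s s' hs hfin hs'
    refine ((hfin.image s).preimage hs'.injOn).subset ?_
    rintro n ⟨m, hm⟩
    exact ⟨m, ⟨n, hm.symm⟩, hm⟩
  refine ⟨c, hinj, fun d d' hne => ?_, fun d y => by rw [hc]; exact hF₃ _ _ y⟩
  rcases hne.lt_or_gt with h | h
  · have h₂ := (hlt d' d h).2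
    exact ⟨hflip _ _ (d'.2.2.1.comp (hinj d')) (h₂.subset fun n hn => Or.inl hn)
        (d.2.1.comp (hinj d)),
      hflip _ _ (d'.2.2.1.comp (hinj d')) (h₂.subset fun n hn => Or.inr hn)
        (d.2.2.1.comp (hinj d))⟩
  · exact ⟨(hlt d d' h).1.subset fun n hn => Or.inr hn,
      (hlt d d' h).2.subset fun n hn => Or.inr hn⟩

/-- Sequences `a d` which, together with the branches, generate a superatomic algebra such that no
automorphism maps `d.1.1 m` to `d.1.2 m` for all `m`. -/
theorem exists_rigid_family {L M : Type} (C : AlmostDisjointFamily L M) (hL : 𝔠 < #L)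
    (hD : #(InjPair M T) ≤ #L) :
    ∃ a : InjPair M T → ℕ → T, (∀ d, ∀ b ∈ S.algebra a, Unsplit (a d) b) ∧
      ∀ d : InjPair M T, ∀ b ∈ S.algebra a, ∃ m, ¬ (d.1.1 m ∈ b ↔ d.1.2 m ∈ range (a d)) := by
  obtain ⟨c, hinj, hfin, hun⟩ := S.exists_good_family C hL hD
  have htwo : StrictMono fun n : ℕ => 2 * n := fun m n h => by dsimp only; omega
  let a : InjPair M T → ℕ → T := fun d n => d.1.2 (c d (2 * n))
  have hsub : ∀ d, range (a d) ⊆ range (d.1.2 ∘ c d) := by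
    rintro d _ ⟨n, rfl⟩
    exact ⟨2 * n, rfl⟩
  have hsingle : ∀ s : ℕ → T, Function.Injective s → ∀ t, Unsplit s {t} := fun s hs t =>
    unsplit_of_finite ((finite_singleton t).preimage hs.injOn)
  refine ⟨a, fun d b hb => Unsplit.of_closure ?_ hb, fun d b hb => ?_⟩
  · rintro _ ((⟨t, rfl⟩ | ⟨d', rfl⟩) | ⟨y, rfl⟩)
    · exact hsingle _ (d.2.2.1.comp ((hinj d).comp htwo.injective)) t
    · by_cases hd : d = d'
      · subst hd
        exact Or.inl (Eventually.of_forall fun n => ⟨n, rfl⟩)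
      · exact (unsplit_of_finite ((hfin d d' hd).2.subset fun n hn => hsub d' hn)).comp htwo
    · exact (hun d y).2.comp htwo
  · have hb' : Unsplit (d.1.1 ∘ c d) b := by
      refine Unsplit.of_closure ?_ hb
      rintro _ ((⟨t, rfl⟩ | ⟨d', rfl⟩) | ⟨y, rfl⟩)
      · exact hsingle _ (d.2.1.comp (hinj d)) t
      · refine unsplit_of_finite ?_
        by_cases hd : d = d'
        · subst hd
          convert finite_empty
          refine eq_empty_of_forall_notMem ?_
          rintro n ⟨m, hm⟩
          exact d.2.2.2 _ _ hm.symm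
        · exact (hfin d d' hd).1.subset fun n hn => hsub d' hn
      · exact (hun d y).1
    by_contra! hiff
    have hmem : ∀ n, d.1.1 (c d n) ∈ b ↔ Even n := fun n => by
      rw [hiff, even_iff_two_dvd]
      constructor
      · rintro ⟨k, hk⟩
        exact ⟨k, (hinj d (d.2.2.1 hk)).symm⟩
      · rintro ⟨k, rfl⟩
        exact ⟨k, rfl⟩
    rcases hb' with h | h <;> obtain ⟨N, hN⟩ := eventually_atTop.1 h
    · have := (hmem _).1 (hN (2 * N + 1) (by omega))
      exact Nat.not_even_two_mul_add_one N this
    · exact hN (2 * N) (by omega) ((hmem _).2 (even_two_mul N))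

end BranchSystem

section Automorphisms

variable {T : Type} {B : BooleanSubalgebra (Set T)}

theorem isAtom_iff_exists_singleton (hB : ∀ t, {t} ∈ B) (b : B) :
    IsAtom b ↔ ∃ t, b = ⟨{t}, hB t⟩ := by
  constructor
  · intro hb
    obtain ⟨t, ht⟩ : (b : Set T).Nonempty := by
      rw [nonempty_iff_ne_empty]
      exact fun h => hb.1 (Subtype.ext h)
    have hle : (⟨{t}, hB t⟩ : B) ≤ b := show ({t} : Set T) ⊆ b from singleton_subset_iff.2 ht
    refine ⟨t, ((hb.le_iff.1 hle).resolve_left fun h => ?_).symm⟩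
    exact singleton_ne_empty t (congrArg Subtype.val h)
  · rintro ⟨t, rfl⟩
    refine ⟨fun h => singleton_ne_empty t (congrArg Subtype.val h), fun b hb => ?_⟩
    have hsub : (b : Set T) ⊆ {t} := hb.le
    rcases subset_singleton_iff_eq.1 hsub with h | h
    · exact Subtype.ext h
    · exact absurd (Subtype.ext h) hb.ne

theorem mk_isAtom_eq (hB : ∀ t, {t} ∈ B) : #{b : B // IsAtom b} = #T := by
  refine (mk_congr (Equiv.ofBijective
    (fun t => (⟨⟨{t}, hB t⟩, (isAtom_iff_exists_singleton hB _).2 ⟨t, rfl⟩⟩ :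
      {b : B // IsAtom b})) ⟨fun t t' h => ?_, fun ⟨b, hb⟩ => ?_⟩)).symm
  · exact singleton_injective (congrArg (fun b => (b.1.1 : Set T)) h)
  · obtain ⟨t, rfl⟩ := (isAtom_iff_exists_singleton hB b).1 hb
    exact ⟨t, rfl⟩

/-- An automorphism of an algebra of sets containing the singletons is induced by a
permutation. -/
theorem exists_perm_of_orderIso_s6 (hB : ∀ t, {t} ∈ B) (φ : B ≃o B) :
    ∃ π : Equiv.Perm T, ∀ (t : T) (b : B), t ∈ (b : Set T) ↔ π t ∈ (φ b : Set T) := by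
  have key : ∀ ψ : B ≃o B, ∃ f : T → T,
      ∀ (t : T) (b : B), t ∈ (b : Set T) ↔ f t ∈ (ψ b : Set T) := by
    intro ψ
    have hatom : ∀ t, ∃ t', ψ ⟨{t}, hB t⟩ = ⟨{t'}, hB t'⟩ := fun t =>
      (isAtom_iff_exists_singleton hB _).1
        ((ψ.isAtom_iff _).2 ((isAtom_iff_exists_singleton hB _).2 ⟨t, rfl⟩))
    choose f hf using hatom
    refine ⟨f, fun t b => ?_⟩
    have hle := ψ.le_iff_le (x := ⟨{t}, hB t⟩) (y := b)
    rw [hf] at hle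
    rw [← singleton_subset_iff, ← singleton_subset_iff (s := (ψ b : Set T))]
    exact hle.symm
  have inv : ∀ (ψ : B ≃o B) (f g : T → T),
      (∀ (t : T) (b : B), t ∈ (b : Set T) ↔ f t ∈ (ψ b : Set T)) →
      (∀ (t : T) (b : B), t ∈ (b : Set T) ↔ g t ∈ (ψ.symm b : Set T)) → ∀ t, g (f t) = t := by
    intro ψ f g hf hg t
    have := (hg _ _).1 ((hf t ⟨{t}, hB t⟩).1 rfl)
    rw [OrderIso.symm_apply_apply] at this
    exact this
  obtain ⟨f, hf⟩ := key φ
  obtain ⟨g, hg⟩ := key φ.symm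
  exact ⟨⟨f, g, inv φ f g hf hg, inv φ.symm g f hg hf⟩, hf⟩

theorem mk_orderIso_le_s6 {c μ : Cardinal} (hB : ∀ t, {t} ∈ B) (hT : #T ≤ c) (hc : ℵ₀ ≤ c)
    (hμ : c ^ μ ≤ c)
    (h : ∀ π : Equiv.Perm T, (∃ φ : B ≃o B, ∀ (t : T) (b : B),
      t ∈ (b : Set T) ↔ π t ∈ (φ b : Set T)) → #{t | π t ≠ t} ≤ μ) :
    #(B ≃o B) ≤ c := by
  choose π hπ using exists_perm_of_orderIso_s6 hB
  let G : (B ≃o B) → Set (T × T) := fun φ => (fun t => (t, π φ t)) '' {t | π φ t ≠ t}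
  have hG : ∀ φ t, (t, π φ t) ∈ G φ ↔ π φ t ≠ t := by
    refine fun φ t => ⟨?_, fun ht => ⟨t, ht, rfl⟩⟩
    rintro ⟨s, hs, hst⟩
    obtain rfl := (Prod.mk.inj hst).1
    exact hs
  have hval : ∀ φ t s, (t, s) ∈ G φ → π φ t = s := by
    rintro φ t s ⟨s', _, h⟩
    obtain ⟨rfl, rfl⟩ := Prod.mk.inj h
    rfl
  have hinj : Function.Injective
      fun φ => (⟨G φ, mk_image_le.trans (h _ ⟨φ, hπ φ⟩)⟩ : {s : Set (T × T) // #s ≤ μ}) := by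
    intro φ ψ hφψ
    have hGeq : G φ = G ψ := congrArg Subtype.val hφψ
    have hπeq : ∀ t, π φ t = π ψ t := by
      intro t
      by_cases ht : π φ t = t
      · by_cases ht' : π ψ t = t
        · rw [ht, ht']
        · exact absurd (hval φ t _ (hGeq ▸ (hG ψ t).2 ht')) (by rw [ht]; exact fun h => ht' h.symm)
      · exact (hval ψ t _ (hGeq ▸ (hG φ t).2 ht)).symm
    ext b y
    obtain ⟨t, rfl⟩ := (π φ).surjective y
    rw [← hπ φ, hπeq, ← hπ ψ]
  calc #(B ≃o B) ≤ _ := mk_le_of_injective hinj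
    _ ≤ max #(T × T) ℵ₀ ^ μ := mk_bounded_set_le _ _
    _ ≤ c ^ μ := by
      refine power_le_power_right (max_le ?_ hc)
      rw [← mul_def]
      exact mul_le_of_le hc hT hT
    _ ≤ c := hμ

/-- Transpositions induce automorphisms of algebras of sets containing the finite sets. -/
theorem le_mk_orderIso (hB : ∀ s : Set T, s.Finite → s ∈ B) : #T ≤ #(B ≃o B) := by
  classical
  cases isEmpty_or_nonempty T with
  | inl h => simp
  | inr h =>
    obtain ⟨t₀⟩ := h
    have hswap : ∀ t, ∀ b ∈ B, Equiv.swap t₀ t ⁻¹' b ∈ B := by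
      intro t b hb
      have heq : Equiv.swap t₀ t ⁻¹' b =
          (b \ {t₀, t}) ∪ (Equiv.swap t₀ t ⁻¹' b ∩ {t₀, t}) := by
        ext s
        by_cases h₁ : s = t₀
        · simp [h₁]
        · by_cases h₂ : s = t
          · simp [h₂]
          · simp [h₁, h₂, Equiv.swap_apply_of_ne_of_ne h₁ h₂]
      rw [heq]
      exact BooleanSubalgebra.sup_mem
        (BooleanSubalgebra.sdiff_mem hb (hB _ (toFinite _)))
        (hB _ ((toFinite {t₀, t}).subset inter_subset_right))
    let F : T → (B ≃o B) := fun t =>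
      { toFun := fun b => ⟨Equiv.swap t₀ t ⁻¹' b, hswap t b b.2⟩
        invFun := fun b => ⟨Equiv.swap t₀ t ⁻¹' b, hswap t b b.2⟩
        left_inv := fun b => Subtype.ext (by ext s; simp)
        right_inv := fun b => Subtype.ext (by ext s; simp)
        map_rel_iff' := (Equiv.swap t₀ t).surjective.preimage_subset_preimage_iff }
    refine mk_le_of_injective (f := F) fun t t' htt => ?_
    have h₁ := congrArg (fun φ : B ≃o B => (φ ⟨{t₀}, hB _ (finite_singleton t₀)⟩ : Set T)) htt
    have h₂ : t ∈ Equiv.swap t₀ t' ⁻¹' {t₀} := by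
      rw [← show Equiv.swap t₀ t ⁻¹' {t₀} = Equiv.swap t₀ t' ⁻¹' {t₀} from h₁]
      simp
    have h₃ : Equiv.swap t₀ t' t = t₀ := h₂
    exact (Equiv.swap t₀ t').injective (h₃.trans (Equiv.swap_apply_right t₀ t').symm)

/-- A permutation with large support moves a large set to a set disjoint from it. -/
theorem exists_large_free_set {μ : Cardinal} (hμ : ℵ₀ ≤ μ) (π : Equiv.Perm T)
    (h : μ < #{t | π t ≠ t}) : ∃ E : Set T, μ ≤ #E ∧ ∀ x ∈ E, ∀ y ∈ E, x ≠ π y := by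
  obtain ⟨E, hE⟩ := zorn_subset {E : Set T | ∀ x ∈ E, ∀ y ∈ E, x ≠ π y} fun c hc hchain => by
    refine ⟨⋃₀ c, ?_, fun s hs => subset_sUnion_of_mem hs⟩
    rintro x ⟨s, hs, hx⟩ y ⟨s', hs', hy⟩
    rcases hchain.total hs hs' with hss | hss
    · exact hc hs' x (hss hx) y hy
    · exact hc hs x hx y (hss hy)
  refine ⟨E, ?_, hE.prop⟩
  by_contra! hlt
  have hsub : {t | π t ≠ t} ⊆ E ∪ π '' E ∪ π.symm '' E := by
    intro t ht
    by_contra hnot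
    simp only [mem_union, not_or] at hnot
    obtain ⟨⟨h₁, h₂⟩, h₃⟩ := hnot
    refine h₁ (hE.le_of_ge (y := insert t E) ?_ (subset_insert t E) (mem_insert t E))
    rintro x (rfl | hx) y (rfl | hy) hxy
    · exact ht hxy.symm
    · exact h₂ ⟨y, hy, hxy.symm⟩
    · exact h₃ ⟨x, hx, by simp [hxy]⟩
    · exact hE.prop x hx y hy hxy
  refine (h.trans_le (mk_le_mk_of_subset hsub)).not_gt ?_
  refine (mk_union_le _ _).trans_lt (add_lt_of_lt hμ ?_ (mk_image_le.trans_lt hlt))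
  exact (mk_union_le _ _).trans_lt (add_lt_of_lt hμ hlt (mk_image_le.trans_lt hlt))

end Automorphisms

/-- The tree of all subsets of proper initial segments, with all branches. -/
def treeBranchSystem (K : Type) [LinearOrder K] [WellFoundedLT K] :
    BranchSystem (Σ k : K, Set (Iic k)) (Set K) (WithTop K) where
  seg X w := {t | (t.1 : WithTop K) < w ∧ t.2 = Subtype.val ⁻¹' X}
  subset_or_inter X w Y := by
    by_cases h : ∃ k : K, (k : WithTop K) < w ∧
      (Subtype.val ⁻¹' X : Set (Iic k)) ≠ Subtype.val ⁻¹' Y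
    · right
      obtain ⟨k, ⟨hkw, hk⟩, hmin⟩ := wellFounded_lt.has_min
        {k : K | (k : WithTop K) < w ∧ (Subtype.val ⁻¹' X : Set (Iic k)) ≠ Subtype.val ⁻¹' Y} h
      refine ⟨k, hkw, ?_⟩
      ext ⟨i, s⟩
      constructor
      · rintro ⟨⟨hi, hX⟩, -, hY⟩
        refine ⟨WithTop.coe_lt_coe.2 (lt_of_not_ge fun hki => hk ?_), hX⟩
        ext ⟨j, hj⟩
        exact Set.ext_iff.1 (hX.symm.trans hY) ⟨j, (mem_Iic.1 hj).trans hki⟩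
      · rintro ⟨hi, hX⟩
        refine ⟨⟨hi.trans hkw, hX⟩, WithTop.coe_lt_top _, hX.trans ?_⟩
        by_contra hne
        exact hmin i ⟨hi.trans hkw, hne⟩ (WithTop.coe_lt_coe.1 hi)
    · left
      push Not at h
      rintro ⟨i, s⟩ ⟨hi, hX⟩
      exact ⟨WithTop.coe_lt_top _, hX.trans (h i hi)⟩

theorem treeBranchSystem_injective (K : Type) [LinearOrder K] [WellFoundedLT K] :
    Function.Injective fun X => (treeBranchSystem K).seg X ⊤ := by
  intro X Y h
  have key : ∀ k, (Subtype.val ⁻¹' X : Set (Iic k)) = Subtype.val ⁻¹' Y := fun k =>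
    ((Set.ext_iff.1 h ⟨k, Subtype.val ⁻¹' X⟩).1 ⟨WithTop.coe_lt_top _, rfl⟩).2
  ext k
  exact Set.ext_iff.1 (key k) ⟨k, mem_Iic.2 le_rfl⟩

theorem mk_Iic_lt {c : Cardinal} (hc : ℵ₀ ≤ c) (k : c.ord.ToType) : #(Iic k) < c := by
  rw [← Iio_insert]
  refine mk_insert_le.trans_lt (add_lt_of_lt hc ?_ (one_lt_aleph0.trans_le hc))
  simpa using mk_Iio_lt k

theorem mk_tree {κ lam : Cardinal} (hκ : ℵ₀ ≤ κ) (hle : κ ≤ lam)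
    (h : ∀ θ < κ, (2 : Cardinal) ^ θ ≤ lam) (hpow : ∃ θ < κ, (2 : Cardinal) ^ θ = lam) :
    #(Σ k : κ.ord.ToType, Set (Iic k)) = lam := by
  apply le_antisymm
  · rw [mk_sigma]
    refine (sum_le_mk_mul_iSup _).trans (mul_le_of_le (hκ.trans hle) (by simpa using hle) ?_)
    exact ciSup_le' fun k => by rw [mk_set]; exact h _ (mk_Iic_lt hκ k)
  · obtain ⟨θ, hθ, rfl⟩ := hpow
    let k : κ.ord.ToType := Ordinal.ToType.mk ⟨θ.ord, ord_lt_ord.2 hθ⟩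
    calc (2 : Cardinal) ^ θ ≤ 2 ^ #(Iic k) := by
          refine power_le_power_left two_ne_zero ?_
          have hk : #(Iio k) = θ := by
            change (Ordinal.typein (α := κ.ord.ToType) (· < ·) k).card = θ
            rw [← card_ord θ]
            congr 1
            exact congrArg Subtype.val (Ordinal.ToType.mk.symm_apply_apply _)
          exact hk.symm.le.trans (mk_le_mk_of_subset Iio_subset_Iic_self)
      _ = #(Set (Iic k)) := mk_set.symm
      _ ≤ _ := mk_le_of_injective
        (f := fun s => (⟨k, s⟩ : Σ k : κ.ord.ToType, Set (Iic k)))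
        fun s t h => eq_of_heq (Sigma.mk.inj_iff.1 h).2

/-- A strong limit cardinal `μ` of countable cofinality carries an almost disjoint family of
`2 ^ μ` countable sets. -/
theorem exists_almostDisjointFamily {μ : Cardinal} (hsl : μ.IsStrongLimit)
    (hcf : μ.ord.cof = ℵ₀) :
    ∃ L M : Type, #L = 2 ^ μ ∧ #M ≤ μ ∧ Nonempty M ∧ Nonempty (AlmostDisjointFamily L M) := by
  have hμ := hsl.aleph0_le
  let O := μ.ord.ToType
  obtain ⟨S, hS, hScard⟩ := Order.exists_cof_eq (α := O)
  rw [Ordinal.cof_toType, hcf] at hScard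
  obtain ⟨u⟩ := Cardinal.eq.1 (mk_nat.trans hScard.symm)
  let f : ℕ → O := fun n => u n
  let g : ℕ → O := partialSups f
  have hg : ∀ x, ∃ n, ∀ m ≥ n, x ≤ g m := by
    intro x
    obtain ⟨y, hy, hxy⟩ := hS x
    refine ⟨u.symm ⟨y, hy⟩, fun m hm => ?_⟩
    refine hxy.trans (le_trans ?_ (le_partialSups_of_le f hm))
    simp [f]
  refine ⟨Set O, Σ n, Set (Iic (g n)), ?_, ?_, ⟨⟨0, ∅⟩⟩, ⟨?_⟩⟩
  · rw [mk_set, mk_ord_toType]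
  · rw [mk_sigma]
    refine (sum_le_mk_mul_iSup _).trans (mul_le_of_le hμ (by simpa using hμ) ?_)
    exact ciSup_le' fun n => by
      rw [mk_set]; exact (hsl.isStrongPrelimit (mk_Iic_lt hμ _)).le
  · refine ⟨fun X n => ⟨n, Subtype.val ⁻¹' X⟩, fun X m n h => (Sigma.mk.inj_iff.1 h).1, ?_⟩
    intro X Y hXY
    obtain ⟨x, hx⟩ : ∃ x, ¬ (x ∈ X ↔ x ∈ Y) := by
      by_contra! h
      exact hXY (Set.ext h)
    obtain ⟨n, hn⟩ := hg x
    refine (finite_lt_nat n).subset ?_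
    rintro m ⟨m', hm'⟩
    by_contra hlt
    obtain ⟨rfl, heq⟩ := Sigma.mk.inj_iff.1 hm'
    exact hx (Set.ext_iff.1 (eq_of_heq heq) ⟨x, hn _ (not_lt.1 hlt)⟩).symm

/-- If `μ` is strong limit singular of countable cofinality, `λ = 2^μ`, and `κ` is the least
cardinal with `2^κ > λ`, then there is a superatomic Boolean algebra `B` with `|B| = 2^κ`,
`|Atom(B)| = 2^{<κ} + μ`, `2^{<κ} + μ ≤ |Aut(B)| ≤ λ`; in particular `|Aut(B)| < |B|`. -/
theorem exists_superatomic_aut_lt_card_of_least (μ lam κ : Cardinal)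
    (hsl : μ.IsStrongLimit) (hsing : ℵ₀ < μ) (hcf : μ.ord.cof = ℵ₀)
    (hlam : lam = (2 : Cardinal) ^ μ)
    (hκ : lam < (2 : Cardinal) ^ κ) (hκleast : ∀ θ : Cardinal, θ < κ → (2 : Cardinal) ^ θ ≤ lam) :
    ∃ (B : Type) (_ : BooleanAlgebra B), Superatomic B ∧
      #B = (2 : Cardinal) ^ κ ∧
      #{a : B // IsAtom a} = (2 : Cardinal) ^< κ + μ ∧
      (2 : Cardinal) ^< κ + μ ≤ #(B ≃o B) ∧ #(B ≃o B) ≤ lam ∧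
      #(B ≃o B) < #B := by
  have hμlam : μ < lam := hlam ▸ cantor μ
  have hlam₀ : ℵ₀ ≤ lam := hsing.le.trans hμlam.le
  have hμκ : μ < κ := by
    by_contra! h
    exact (hκ.trans_le (power_le_power_left two_ne_zero h)).ne hlam
  have hκ₀ : ℵ₀ ≤ κ := hsing.le.trans hμκ.le
  have hκlam : κ ≤ lam := by
    by_contra! h
    exact (cantor lam).not_ge (hκleast lam h)
  have hpowlt : (2 : Cardinal) ^< κ + μ = lam := by
    have : (2 : Cardinal) ^< κ = lam :=
      le_antisymm (powerlt_le.2 hκleast) (hlam ▸ le_powerlt 2 hμκ)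
    rw [this, add_eq_left hlam₀ hμlam.le]
  have hlampow : lam ^ μ = lam := by
    rw [hlam, ← power_mul, mul_eq_self hsing.le]
  have hcont : 𝔠 < lam := by
    rw [← two_power_aleph0]
    exact (hsl.isStrongPrelimit hsing).trans hμlam
  obtain ⟨L, M, hL, hM, _, ⟨C⟩⟩ := exists_almostDisjointFamily hsl hcf
  rw [← hlam] at hL
  let S := treeBranchSystem κ.ord.ToType
  have hT : #(Σ k : κ.ord.ToType, Set (Iic k)) = lam :=
    mk_tree hκ₀ hκlam hκleast ⟨μ, hμκ, hlam.symm⟩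
  have hD : #(InjPair M (Σ k : κ.ord.ToType, Set (Iic k))) ≤ lam := by
    refine mk_injPair_le hlam₀ ?_
    rw [hT]
    exact (power_le_power_left (aleph0_pos.trans_le hlam₀).ne' hM).trans hlampow.le
  obtain ⟨a, ha, hrigid⟩ := S.exists_rigid_family C (hL ▸ hcont) (hL ▸ hD)
  have hcardB : #(S.algebra a) = 2 ^ κ := by
    have hX : #(Set κ.ord.ToType) = 2 ^ κ := by rw [mk_set, mk_ord_toType]
    apply le_antisymm
    · have hinf := hlam₀.trans hκ.le
      refine mk_booleanSubalgebra_closure_le _ hinf ((mk_union_le _ _).trans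
        (add_le_of_le hinf ((mk_union_le _ _).trans (add_le_of_le hinf ?_ ?_)) ?_))
      · exact mk_range_le.trans (hT.trans_le hκ.le)
      · exact mk_range_le.trans (hD.trans hκ.le)
      · exact mk_range_le.trans hX.le
    · rw [← hX]
      refine mk_le_of_injective
        (f := fun X => (⟨S.seg X ⊤, S.seg_mem_algebra X⟩ : S.algebra a)) fun X Y h => ?_
      exact treeBranchSystem_injective _ (congrArg Subtype.val h)
  have haut : #(S.algebra a ≃o S.algebra a) ≤ lam := by
    refine mk_orderIso_le_s6 S.singleton_mem_algebra hT.le hlam₀ hlampow.le ?_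
    rintro π ⟨φ, hφ⟩
    by_contra! hlt
    obtain ⟨E, hE, hfree⟩ := exists_large_free_set hsing.le π hlt
    obtain ⟨e⟩ : Nonempty (M ↪ E) := hM.trans hE
    let d : InjPair M (Σ k : κ.ord.ToType, Set (Iic k)) :=
      ⟨(fun m => e m, fun m => π (e m)), Subtype.val_injective.comp e.injective,
        π.injective.comp (Subtype.val_injective.comp e.injective),
        fun m m' => hfree _ (e m).2 _ (e m').2⟩
    obtain ⟨m, hm⟩ := hrigid d (φ.symm ⟨range (a d), S.range_mem_algebra d⟩) (Subtype.prop _)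
    refine hm ((hφ _ _).trans ?_)
    rw [OrderIso.apply_symm_apply]
  refine ⟨S.algebra a, inferInstance, S.superatomic_algebra ha, hcardB, ?_, ?_, haut, ?_⟩
  · rw [mk_isAtom_eq S.singleton_mem_algebra, hT, hpowlt]
  · rw [hpowlt, ← hT]
    exact le_mk_orderIso fun s hs => S.finite_mem_algebra hs
  · rw [hcardB]
    exact haut.trans_lt hκ
end

section
/- Assume μ is a strong limit singular cardinal with cf(μ) = ℵ₀, λ = 2^μ, κ ≤ λ, and T is a tree with a root, with κ levels and at most λ nodes. Then there is a family 𝒜 of countably infinite subsets of T × μ such that: (a) any two distinct members of 𝒜 have finite intersection; (b) for every t ∈ T⁺ and every y ∈ 𝒜, either y ⊆ z_t or y ∩ z_t is finite; (c) whenever Y ⊆ T × μ has cardinality μ and f : Y → (T × μ) \ Y is injective, there is y ∈ 𝒜 with y ⊆ Y such that the image f''y has finite intersection with every member of 𝒜. -/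
open Cardinal

/-- `T` is a tree with `κ` levels: it has a root (least element), the set of predecessors of
every node is well-ordered by `<`, and its order type (the level of the node) is `< κ.ord`. -/
def IsTreeWithLevels (T : Type) [PartialOrder T] (κ : Cardinal) : Prop :=
  (∃ r : T, ∀ t : T, r ≤ t) ∧
  ∀ t : T, ∃ hw : IsWellOrder (Set.Iio t) (· < ·),
    @Ordinal.type (Set.Iio t) (· < ·) hw < κ.ord

/-- A `κ`-branch of a tree `T`: a downward closed chain whose order type under `<` is `κ.ord`. -/
def IsKappaBranch (T : Type) [PartialOrder T] (κ : Cardinal) (b : Set T) : Prop :=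
  IsChain (· < ·) b ∧ (∀ s t : T, s < t → t ∈ b → s ∈ b) ∧
  ∃ hw : IsWellOrder b (· < ·), @Ordinal.type b (· < ·) hw = κ.ord

/-- For a node `t` of `T`, `z_t = {(s,α) : s < t}`. -/
def zNode {T : Type} [PartialOrder T] (M : Type) (t : T) : Set (T × M) := {p | p.1 < t}

/-- For a branch `b` of `T`, `z_b = {(s,α) : s ∈ b}`. -/
def zBranch {T : Type} [PartialOrder T] (M : Type) (b : Set T) : Set (T × M) := {p | p.1 ∈ b}

/-- Definition by well-founded recursion, where each value is only required to be related to the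
previously chosen ones. -/
theorem exists_forall_of_wellFounded {ι α : Type*} {r : ι → ι → Prop} (hr : WellFounded r)
    (P : ∀ i, ({j // r j i} → α) → α → Prop) (h : ∀ i f, ∃ a, P i f a) :
    ∃ c : ι → α, ∀ i, P i (fun j => c j) (c i) := by
  choose F hF using h
  refine ⟨hr.fix fun i ih => F i fun j => ih j.1 j.2, fun i => ?_⟩
  rw [hr.fix_eq _ i]
  exact hF i _

/-- Every sequence in a well-founded partial order has a subsequence that is contained
in, or eventually disjoint from, every chain that is a lower set. -/
theorem exists_subseq_forall_chain {T : Type*} [PartialOrder T] [WellFoundedLT T] (v : ℕ → T) :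
    ∃ g : ℕ ↪o ℕ, ∀ b : Set T, IsChain (· < ·) b → IsLowerSet b →
      (∀ n, v (g n) ∈ b) ∨ {n | v (g n) ∈ b}.Finite := by
  obtain ⟨g, hg | hg⟩ := exists_increasing_or_nonincreasing_subseq (· < ·) v
  · refine ⟨g, fun b _ hb => or_iff_not_imp_left.2 fun h => ?_⟩
    obtain ⟨n, hn⟩ := not_forall.1 h
    refine (Set.finite_Iio n).subset fun m hm => ?_
    by_contra hmn
    have hmono : StrictMono fun k => v (g k) := fun _ _ h => hg _ _ h
    exact hn (hb (hmono.monotone (not_lt.1 hmn)) hm)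
  obtain ⟨k, hk | hk⟩ := exists_increasing_or_nonincreasing_subseq (· ≥ ·) fun n => v (g n)
  · have hanti : Antitone fun n => v (g (k n)) :=
      antitone_nat_of_succ_le fun n => hk _ _ n.lt_succ_self
    obtain ⟨N, hN⟩ := WellFoundedLT.antitone_chain_condition hanti
    let e : ℕ ↪o ℕ := OrderEmbedding.ofStrictMono (fun n => g (k (N + n))) fun a b hab => by
      simpa using hab
    refine ⟨e, fun b _ _ => ?_⟩
    have he : ∀ n, v (e n) = v (g (k N)) := fun n => (hN (N + n) (Nat.le_add_right _ _)).symm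
    by_cases h : v (g (k N)) ∈ b <;> simp [he, h]
  · refine ⟨k.trans g, fun b hb _ => Or.inr (Set.Subsingleton.finite ?_)⟩
    have key : ∀ m n, m < n → v (g (k m)) ∈ b → v (g (k n)) ∈ b → False := by
      intro m n hmn hm hn
      by_cases heq : v (g (k m)) = v (g (k n))
      · exact hk m n hmn heq.ge
      rcases hb hm hn heq with h | h
      · exact hg _ _ (k.strictMono hmn) h
      · exact hk m n hmn h.le
    intro m hm n hn
    rcases lt_trichotomy m n with h | h | h
    · exact (key m n h hm hn).elim
    · exact h
    · exact (key n m h hn hm).elim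

/-- A set version of `exists_subseq_forall_chain`. -/
theorem Set.Infinite.exists_subset_forall_chain {α T : Type*} [PartialOrder T] [WellFoundedLT T]
    (u : α → T) {s : Set α} (hs : s.Infinite) :
    ∃ c ⊆ s, c.Countable ∧ c.Infinite ∧ ∀ b : Set T, IsChain (· < ·) b → IsLowerSet b →
      c ⊆ u ⁻¹' b ∨ (c ∩ u ⁻¹' b).Finite := by
  have := hs.to_subtype
  let p := _root_.Infinite.natEmbedding s
  obtain ⟨g, hg⟩ := exists_subseq_forall_chain fun n => u (p n)
  have hinj : Function.Injective fun n => (p (g n) : α) :=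
    Subtype.val_injective.comp (p.injective.comp g.injective)
  refine ⟨Set.range fun n => (p (g n) : α), ?_, Set.countable_range _,
    Set.infinite_range_of_injective hinj, fun b hb hb' => ?_⟩
  · rintro _ ⟨n, rfl⟩
    exact (p (g n)).2
  · rcases hg b hb hb' with h | h
    · left
      rintro _ ⟨n, rfl⟩
      exact h n
    · right
      refine (h.image fun n => (p (g n) : α)).subset ?_
      rintro _ ⟨⟨n, rfl⟩, hn⟩
      exact ⟨n, hn, rfl⟩

/-- If a family of countable subsets of `α` is so small that `#J * 𝔠 < #α ^ ℵ₀`, there is an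
infinite set almost disjoint from all its members. -/
theorem exists_infinite_inter_finite {α J : Type} [Infinite α] (C : J → Set α)
    (hC : ∀ j, (C j).Countable) (hJ : #J * 𝔠 < #α ^ ℵ₀) :
    ∃ c : Set α, c.Infinite ∧ ∀ j, (c ∩ C j).Finite := by
  obtain ⟨e⟩ : Nonempty (List α ≃ α) := Cardinal.eq.1 (mk_list_eq_mk α)
  let b : (ℕ → α) → ℕ → α := fun g n => e ((List.range n).map g)
  have hb : ∀ g g' m n, b g m = b g' n → m = n ∧ ∀ k < m, g k = g' k := by
    intro g g' m n h
    have h' := e.injective h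
    have hmn : m = n := by simpa using congrArg List.length h'
    subst hmn
    refine ⟨rfl, fun k hk => ?_⟩
    exact List.map_inj_left.1 h' k (List.mem_range.2 hk)
  by_contra! hcon
  have hex : ∀ g, ∃ j, (Set.range (b g) ∩ C j).Infinite := fun g =>
    hcon _ (Set.infinite_range_of_injective fun m n h => (hb g g m n h).1)
  choose j hj using hex
  let Φ : (ℕ → α) → Σ j, Set (C j) := fun g => ⟨j g, {x | (x : α) ∈ Set.range (b g)}⟩
  have hΦ : Function.Injective Φ := by
    intro g g' h
    obtain ⟨hjj, hset⟩ := Sigma.mk.inj h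
    have hsub : ∀ x ∈ C (j g), x ∈ Set.range (b g) → x ∈ Set.range (b g') := by
      have : ∀ (i i' : J) (S S' : Set α), i = i' →
          HEq {x : C i | (x : α) ∈ S} {x : C i' | (x : α) ∈ S'} → ∀ x ∈ C i, x ∈ S → x ∈ S' := by
        rintro i _ S S' rfl h x hx hxS
        have : (⟨x, hx⟩ : C i) ∈ {x : C i | (x : α) ∈ S'} := by
          rw [← eq_of_heq h]
          exact hxS
        exact this
      exact this _ _ _ _ hjj hset
    funext k
    have hinf : {n | b g n ∈ C (j g)}.Infinite := fun hfin => hj g <|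
      (hfin.image (b g)).subset <| by
        rintro _ ⟨⟨n, rfl⟩, hn⟩
        exact ⟨n, hn, rfl⟩
    obtain ⟨n, hn, hkn⟩ := hinf.exists_gt k
    obtain ⟨m, hm⟩ := hsub _ hn ⟨n, rfl⟩
    exact (hb _ _ _ _ hm.symm).2 k hkn
  have hle := mk_le_of_injective hΦ
  refine hle.not_gt (lt_of_le_of_lt ?_ (hJ.trans_eq (by simp)))
  rw [mk_sigma, ← sum_const']
  refine sum_le_sum _ _ fun i => ?_
  rw [mk_set, ← two_power_aleph0]
  exact power_le_power_left two_ne_zero (hC i).le_aleph0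

/-- Given at most `#M ^ ℵ₀` pairs of injections `u i`, `v i` of `M` into `X` with disjoint ranges,
there are infinite `c i ⊆ M` whose images under the `u i` are almost disjoint from each other and
from the images under the `v i`. Each `c i` can moreover be chosen to satisfy a condition `G i`
that holds for some countably infinite subset of any infinite set. -/
theorem exists_almost_disjoint_images {ι M X : Type} [Infinite M] (u v : ι → M → X)
    (hu : ∀ i, Function.Injective (u i)) (hv : ∀ i, Function.Injective (v i))
    (huv : ∀ i m m', v i m ≠ u i m') (hι : #ι ≤ #M ^ ℵ₀) (h𝔠 : 𝔠 < #M ^ ℵ₀)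
    (G : ι → Set M → Prop)
    (hG : ∀ i, ∀ s : Set M, s.Infinite → ∃ c ⊆ s, c.Countable ∧ c.Infinite ∧ G i c) :
    ∃ c : ι → Set M, (∀ i, (c i).Countable ∧ (c i).Infinite ∧ G i (c i)) ∧
      (∀ i j, i ≠ j → (u i '' c i ∩ u j '' c j).Finite) ∧
      ∀ i j, (v i '' c i ∩ u j '' c j).Finite := by
  obtain ⟨_, _, hord⟩ := exists_ord_eq_type_lt ι
  let B : ι → ι → Set M → Set M := fun i j d =>
    u i ⁻¹' (u j '' d ∪ v j '' d) ∪ v i ⁻¹' (u j '' d)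
  have hstep : ∀ (i : ι) (d : {j // j < i} → {c : Set M // c.Countable}),
      ∃ c : {c : Set M // c.Countable}, (c : Set M).Infinite ∧ G i c ∧
        ∀ j : {j // j < i}, ((c : Set M) ∩ B i j (d j)).Finite := by
    intro i d
    obtain ⟨s, hs, hsB⟩ := exists_infinite_inter_finite (fun j : {j // j < i} => B i j (d j))
      (fun j => (((((d j).2.image _).union ((d j).2.image _)).preimage (hu i))).union
        (((d j).2.image _).preimage (hv i)))
      (mul_lt_of_lt (aleph0_le_continuum.trans h𝔠.le) ((mk_Iio_lt i hord).trans_le hι) h𝔠)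
    obtain ⟨c, hcs, hcc, hci, hcG⟩ := hG i s hs
    exact ⟨⟨c, hcc⟩, hci, hcG, fun j => (hsB j).subset (Set.inter_subset_inter_left _ hcs)⟩
  obtain ⟨c, hc⟩ := exists_forall_of_wellFounded (wellFounded_lt (α := ι))
    (fun i (d : {j // j < i} → {c : Set M // c.Countable}) (c : {c : Set M // c.Countable}) =>
      (c : Set M).Infinite ∧ G i c ∧
        ∀ j : {j // j < i}, ((c : Set M) ∩ B i j (d j)).Finite) hstep
  have hfin : ∀ {i j}, j < i → ((c i : Set M) ∩ B i j (c j)).Finite := fun h => (hc _).2.2 ⟨_, h⟩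
  have huu : ∀ {i j}, j < i → (u i '' c i ∩ u j '' c j).Finite := fun {i j} h =>
    ((hfin h).image (u i)).subset <| by
      rintro _ ⟨⟨m, hm, rfl⟩, hj⟩
      exact ⟨m, ⟨hm, Or.inl (Or.inl hj)⟩, rfl⟩
  refine ⟨fun i => c i, fun i => ⟨(c i).2, (hc i).1, (hc i).2.1⟩, fun i j hij => ?_,
    fun i j => ?_⟩
  · rcases hij.lt_or_gt with h | h
    · rw [Set.inter_comm]
      exact huu h
    · exact huu h
  · rcases lt_trichotomy i j with h | rfl | h
    · refine ((hfin h).image (u j)).subset ?_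
      rintro _ ⟨hi, m, hm, rfl⟩
      exact ⟨m, ⟨hm, Or.inl (Or.inr hi)⟩, rfl⟩
    · convert Set.finite_empty
      rw [Set.eq_empty_iff_forall_notMem]
      rintro _ ⟨⟨m, _, rfl⟩, m', _, h⟩
      exact huv i m m' h.symm
    · refine ((hfin h).image (v i)).subset ?_
      rintro _ ⟨⟨m, hm, rfl⟩, hj⟩
      exact ⟨m, ⟨hm, Or.inr hj⟩, rfl⟩

/-- A strong limit cardinal `μ` satisfies `2 ^ μ ≤ μ ^ cof μ`. -/
theorem Cardinal.IsStrongLimit.two_power_le_power_cof {μ : Cardinal} (h : μ.IsStrongLimit) :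
    2 ^ μ ≤ μ ^ μ.ord.cof := by
  obtain ⟨s, hs, hcard⟩ := Order.exists_cof_eq μ.ord.ToType
  rw [Ordinal.cof_toType] at hcard
  have hemb : ∀ x : s, Nonempty (Set (Set.Iio (x : μ.ord.ToType)) ↪ μ.ord.ToType) := by
    intro x
    rw [← Cardinal.le_def, mk_set, mk_ord_toType]
    exact (h.isStrongPrelimit (by simpa using mk_Iio_lt (x : μ.ord.ToType))).le
  let e := fun x => (hemb x).some
  let Φ : Set μ.ord.ToType → s → μ.ord.ToType := fun A x => e x {y | (y : μ.ord.ToType) ∈ A}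
  have hmax : NoMaxOrder μ.ord.ToType := noMaxOrder h.aleph0_le
  have hΦ : Function.Injective Φ := by
    intro A A' hA
    ext y
    obtain ⟨z, hyz⟩ := exists_gt y
    obtain ⟨x, hx, hzx⟩ := hs z
    have := (e ⟨x, hx⟩).injective (congrFun hA ⟨x, hx⟩)
    exact Set.ext_iff.1 this ⟨y, hyz.trans_le hzx⟩
  simpa [hcard] using mk_le_of_injective hΦ

/-- A partial order all of whose initial segments are well-ordered is well-founded. -/
theorem wellFoundedLT_of_isWellOrder_Iio {T : Type*} [PartialOrder T]
    (h : ∀ t : T, IsWellOrder (Set.Iio t) (· < ·)) : WellFoundedLT T := by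
  refine ⟨⟨fun t => Acc.intro t fun s hs => ?_⟩⟩
  have key : ∀ x : Set.Iio t, Acc (· < ·) (x : T) := by
    intro x
    induction x using (h t).wf.induction with
    | _ x ih => exact Acc.intro _ fun y hy => ih ⟨y, hy.trans x.2⟩ hy
  exact key ⟨s, hs⟩

/-- The almost disjoint family used in the construction: a family `𝒜` of countably infinite
subsets of `T × μ`, pairwise almost disjoint, almost contained in or almost disjoint from each
`z_t` (`t ∈ T⁺`), and such that every injective `f : Y → (T × μ) \ Y` with `|Y| = μ` maps some
`y ∈ 𝒜` onto a set almost disjoint from every member of `𝒜`. -/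
theorem exists_almost_disjoint_family (μ lam κ : Cardinal)
    (hsl : μ.IsStrongLimit) (hsing : ℵ₀ < μ) (hcf : μ.ord.cof = ℵ₀)
    (hlam : lam = (2 : Cardinal) ^ μ) (hκ : κ ≤ lam)
    (T : Type) [PartialOrder T] (hT : IsTreeWithLevels T κ) (hTcard : #T ≤ lam)
    (M : Type) (hM : #M = μ) :
    ∃ 𝒜 : Set (Set (T × M)),
      (∀ y ∈ 𝒜, y.Countable ∧ y.Infinite) ∧
      (∀ y ∈ 𝒜, ∀ y' ∈ 𝒜, y ≠ y' → (y ∩ y').Finite) ∧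
      (∀ t : T, ∀ y ∈ 𝒜, y ⊆ zNode M t ∨ (y ∩ zNode M t).Finite) ∧
      (∀ b : Set T, IsKappaBranch T κ b →
        ∀ y ∈ 𝒜, y ⊆ zBranch M b ∨ (y ∩ zBranch M b).Finite) ∧
      (∀ Y : Set (T × M), #Y = μ →
        ∀ f : T × M → T × M, Set.InjOn f Y → (∀ x ∈ Y, f x ∉ Y) →
          ∃ y ∈ 𝒜, y ⊆ Y ∧ ∀ y' ∈ 𝒜, (f '' y ∩ y').Finite) := by
  subst hlam
  have := wellFoundedLT_of_isWellOrder_Iio fun t => (hT.2 t).1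
  have hμ : ℵ₀ ≤ μ := hsing.le
  have hMinf : Infinite M := infinite_iff.2 (hM ▸ hμ)
  have hpow : (2 : Cardinal) ^ μ ≤ #M ^ ℵ₀ := by
    rw [hM, ← hcf]
    exact hsl.two_power_le_power_cof
  have h𝔠 : 𝔠 < #M ^ ℵ₀ := by
    rw [← two_power_aleph0]
    exact ((hsl.isStrongPrelimit hsing).trans (cantor μ)).trans_le hpow
  let ι := {h : M → (T × M) × (T × M) // Function.Injective (fun m => (h m).1) ∧
    Function.Injective (fun m => (h m).2) ∧ ∀ m m', (h m).2 ≠ (h m').1}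
  have hX : #(T × M) ≤ 2 ^ μ := by
    rw [mk_prod, lift_id, lift_id, hM]
    exact (mul_le_mul' hTcard (cantor μ).le).trans
      (mul_eq_self (hμ.trans (cantor μ).le)).le
  have hι : #ι ≤ #M ^ ℵ₀ := by
    refine (mk_subtype_le _).trans (le_trans ?_ hpow)
    rw [← power_def, hM, mk_prod, lift_id]
    refine (power_le_power_right ((mul_le_mul' hX hX).trans
      (mul_eq_self (hμ.trans (cantor μ).le)).le)).trans ?_
    rw [← power_mul, mul_eq_self hμ]
  obtain ⟨c, hc, huu, hvu⟩ := exists_almost_disjoint_images (ι := ι)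
    (fun i m => (i.1 m).1) (fun i m => (i.1 m).2) (fun i => i.2.1) (fun i => i.2.2.1)
    (fun i => i.2.2.2) hι h𝔠
    (fun i c => ∀ b : Set T, IsChain (· < ·) b → IsLowerSet b →
      c ⊆ (fun m => (i.1 m).1.1) ⁻¹' b ∨ (c ∩ (fun m => (i.1 m).1.1) ⁻¹' b).Finite)
    (fun i s hs => hs.exists_subset_forall_chain fun m => (i.1 m).1.1)
  have hchain : ∀ b : Set T, IsChain (· < ·) b → IsLowerSet b → ∀ i,
      (fun m => (i.1 m).1) '' c i ⊆ zBranch M b ∨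
        ((fun m => (i.1 m).1) '' c i ∩ zBranch M b).Finite := by
    intro b hb hb' i
    refine ((hc i).2.2 b hb hb').imp (fun h => ?_) fun h => ?_
    · rintro _ ⟨m, hm, rfl⟩
      exact h hm
    · refine (h.image fun m => (i.1 m).1).subset ?_
      rintro _ ⟨⟨m, hm, rfl⟩, hb⟩
      exact ⟨m, ⟨hm, hb⟩, rfl⟩
  refine ⟨Set.range fun i => (fun m => (i.1 m).1) '' c i, ?_, ?_, ?_, ?_, ?_⟩
  · rintro _ ⟨i, rfl⟩
    exact ⟨(hc i).1.image _, (hc i).2.1.image i.2.1.injOn⟩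
  · rintro _ ⟨i, rfl⟩ _ ⟨j, rfl⟩ hij
    exact huu i j fun h => hij (by rw [h])
  · rintro t _ ⟨i, rfl⟩
    refine hchain (Set.Iio t) (fun x hx y hy hxy => ?_) (isLowerSet_Iio t) i
    have := (hT.2 t).1
    have hne : (⟨x, hx⟩ : Set.Iio t) ≠ ⟨y, hy⟩ := fun h => hxy (congrArg Subtype.val h)
    rcases trichotomous_of (· < ·) (⟨x, hx⟩ : Set.Iio t) ⟨y, hy⟩ with h | h | h
    · exact Or.inl h
    · exact (hne h).elim
    · exact Or.inr h
  · rintro b ⟨hb, hb', _⟩ _ ⟨i, rfl⟩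
    exact hchain b hb (fun x y hyx hx => hyx.lt_or_eq.elim (fun h => hb' y x h hx) (· ▸ hx)) i
  · intro Y hY f hf hfY
    obtain ⟨e⟩ : Nonempty (M ≃ Y) := Cardinal.eq.1 (hM.trans hY.symm)
    let i : ι := ⟨fun m => ((e m : T × M), f (e m)), Subtype.val_injective.comp e.injective,
      fun m m' h => e.injective (Subtype.ext (hf (e m).2 (e m').2 h)),
      fun m m' h => hfY _ (e m).2 (Eq.mpr (congrArg (· ∈ Y) h) (e m').2)⟩
    refine ⟨_, ⟨i, rfl⟩, ?_, ?_⟩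
    · rintro _ ⟨m, _, rfl⟩
      exact (e m).2
    · rintro _ ⟨j, rfl⟩
      rw [Set.image_image]
      exact hvu i j
end
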